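/- arXiv:1009.0299 — 16 statements merged into one kernel-verified Lean document; each statement's English description precedes it below -/
import Mathlib

section
/- Stability of the deterministic mean reversion regime: Suppose Assumption I' holds with constants δ_m > 0 and c_m > 0, and suppose that |P(t) - P₀| < δ_m for all t ∈ [t₀ - 1, t₀]. Then |P(t) - P₀| < δ_m for all t > t₀. -/
theorem left_max_deriv_nonneg {f : ℝ → ℝ} {d a s : ℝ} (hf : HasDerivAt f d s) (has : a < s)
    (h : ∀ t, a ≤ t → t < s → f t ≤ f s) : 0 ≤ d := by
  have h1 := (hasDerivAt_iff_tendsto_slope.1 hf).mono_left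
    (nhdsWithin_mono s (fun x (hx : x ∈ Set.Iio s) => ne_of_lt hx))
  refine ge_of_tendsto h1 ?_
  filter_upwards [Ico_mem_nhdsLT has] with t ht
  rw [slope_def_field]
  exact div_nonneg_of_nonpos (by linarith [h t ht.1 ht.2]) (by linarith [ht.2])

/-- **Stability of the deterministic mean reversion regime.**
Suppose Assumption I' holds with constants `δm > 0` and `cm > 0`, and suppose that
`|P t - P₀| < δm` for all `t ∈ [t₀ - 1, t₀]`. Then `|P t - P₀| < δm` for all `t > t₀`. -/
theorem deterministic_mean_reversion_stability
    (μ ν P₀ t₀ δm cm : ℝ) (S P : ℝ → ℝ)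
    (hμ : 0 < μ) (hν : 0 < ν)
    (hSodd : ∀ x, S (-x) = -S x) (hSmono : StrictMono S)
    (hP : ∀ t : ℝ, HasDerivAt P (-μ * (1 - Real.exp (P₀ - P t)) + ν * S (P t - P (t - 1))) t)
    (hδm : 0 < δm) (hcm : 0 < cm)
    (hA1 : ∀ x, δm / 4 ≤ x → x ≤ δm →
      -μ * (1 - Real.exp (-x)) + ν * S (x + δm) < -(cm * μ * δm))
    (hA2 : ∀ x, -δm ≤ x → x ≤ -(δm / 4) →
      cm * μ * δm < -μ * (1 - Real.exp (-x)) + ν * S (x - δm))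
    (hinit : ∀ t ∈ Set.Icc (t₀ - 1) t₀, |P t - P₀| < δm) :
    ∀ t, t₀ < t → |P t - P₀| < δm := by
  intro T hT
  by_contra hcon
  have hcont : Continuous P := continuous_iff_continuousAt.2 fun t => (hP t).continuousAt
  have hcl : IsClosed {t : ℝ | δm ≤ |P t - P₀|} :=
    isClosed_le continuous_const (by fun_prop)
  obtain ⟨s, hs, hmin⟩ := (isCompact_Icc.inter_right hcl : IsCompact
    (Set.Icc t₀ T ∩ {t : ℝ | δm ≤ |P t - P₀|})).exists_isLeast
    ⟨T, ⟨hT.le, le_rfl⟩, not_lt.1 hcon⟩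
  obtain ⟨⟨hs0, hsT⟩, hsδ⟩ := hs
  simp only [Set.mem_setOf_eq] at hsδ
  have hlt : ∀ t, t₀ - 1 ≤ t → t < s → |P t - P₀| < δm := by
    intro t h1 h2
    by_cases h3 : t ≤ t₀
    · exact hinit t ⟨h1, h3⟩
    · by_contra h4
      exact absurd (hmin ⟨⟨(not_le.1 h3).le, h2.le.trans hsT⟩, not_lt.1 h4⟩) (not_le.2 h2)
  have hs1 : t₀ < s := by
    rcases hs0.lt_or_eq with h | h
    · exact h
    · have := hinit t₀ ⟨by linarith, le_rfl⟩
      rw [h] at this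
      linarith
  have hle : |P s - P₀| ≤ δm := by
    have h1 : Filter.Tendsto (fun t => |P t - P₀|) (nhdsWithin s (Set.Iio s))
        (nhds |P s - P₀|) :=
      ((by fun_prop : Continuous fun t => |P t - P₀|).tendsto s).mono_left nhdsWithin_le_nhds
    refine le_of_tendsto h1 ?_
    filter_upwards [Ico_mem_nhdsLT hs1] with t ht
    exact (hlt t (by linarith [ht.1]) ht.2).le
  have hpos : 0 < cm * μ * δm := by positivity
  have hprev := abs_lt.1 (hlt (s - 1) (by linarith) (by linarith))
  have heq : |P s - P₀| = δm := le_antisymm hle hsδ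
  rcases (abs_eq hδm.le).1 heq with h | h
  · have h0 := left_max_deriv_nonneg (hP s) hs1 (fun t h1 h2 => by
      linarith [(abs_lt.1 (hlt t (by linarith) h2)).2])
    have hA := hA1 δm (by linarith) le_rfl
    have hS : S (P s - P (s - 1)) ≤ S (δm + δm) := hSmono.monotone (by linarith [hprev.1])
    have hS' := mul_le_mul_of_nonneg_left hS hν.le
    rw [show P₀ - P s = -δm by linarith] at h0
    linarith
  · have h0 := left_max_deriv_nonneg (hP s).fun_neg hs1 (fun t h1 h2 => by
      linarith [(abs_lt.1 (hlt t (by linarith) h2)).1])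
    have hA := hA2 (-δm) le_rfl (by linarith)
    have hS : S (-δm - δm) ≤ S (P s - P (s - 1)) := hSmono.monotone (by linarith [hprev.2])
    have hS' := mul_le_mul_of_nonneg_left hS hν.le
    rw [show P₀ - P s = -(-δm) by linarith] at h0
    linarith
end

section
/- Persistence of the deterministic bubble regime: Suppose ν S(x₅) = μ + x₅ for a real number x₅, and suppose that P(t) - P(t-1) > x₅ for all t ∈ [t₀ - 1, t₀]. Then P(t) - P(t-1) > x₅ for all t > t₀. -/
/-- **Persistence of the deterministic bubble regime.**
Suppose `ν S x₅ = μ + x₅` and `P t - P (t-1) > x₅` for all `t ∈ [t₀ - 1, t₀]`.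
Then `P t - P (t-1) > x₅` for all `t > t₀`. -/
theorem deterministic_bubble_persistence
    (μ ν P₀ t₀ x₅ : ℝ) (S P : ℝ → ℝ)
    (hμ : 0 < μ) (hν : 0 < ν)
    (hSodd : ∀ x, S (-x) = -S x) (hSmono : StrictMono S)
    (hP : ∀ t : ℝ, HasDerivAt P (-μ * (1 - Real.exp (P₀ - P t)) + ν * S (P t - P (t - 1))) t)
    (hroot : ν * S x₅ = μ + x₅)
    (hinit : ∀ t ∈ Set.Icc (t₀ - 1) t₀, x₅ < P t - P (t - 1)) :
    ∀ t, t₀ < t → x₅ < P t - P (t - 1) := by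
  intro t ht
  by_contra hcon
  have hc : Continuous P := continuous_iff_continuousAt.2 fun t => (hP t).continuousAt
  have hX : Continuous fun t => P t - P (t - 1) := by fun_prop
  set A : Set ℝ := Set.Ici t₀ ∩ {t | P t - P (t - 1) ≤ x₅} with hA
  have hAc : IsClosed A := isClosed_Ici.inter (isClosed_le hX continuous_const)
  have hAn : A.Nonempty := ⟨t, ht.le, not_lt.1 hcon⟩
  have hAb : BddBelow A := ⟨t₀, fun s hs => hs.1⟩
  obtain ⟨h1, h2⟩ := hAc.csInf_mem hAn hAb
  set T := sInf A with hT
  simp only [Set.mem_Ici, Set.mem_ofPred_eq] at h1 h2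
  obtain ⟨c, hcm, hceq⟩ := exists_hasDerivAt_eq_slope P
    (fun t => -μ * (1 - Real.exp (P₀ - P t)) + ν * S (P t - P (t - 1)))
    (show T - 1 < T by linarith) hc.continuousOn (fun x _ => hP x)
  have hXc : x₅ < P c - P (c - 1) := by
    by_cases hct : c ≤ t₀
    · exact hinit c ⟨by linarith [hcm.1], hct⟩
    · by_contra hle
      have : T ≤ c := csInf_le hAb ⟨(not_le.1 hct).le, not_lt.1 hle⟩
      linarith [hcm.2]
  have hS := mul_lt_mul_of_pos_left (hSmono hXc) hν
  have he := mul_pos hμ (Real.exp_pos (P₀ - P c))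
  have : T - (T - 1) = 1 := by ring
  rw [this, div_one] at hceq
  nlinarith
end

section
/- Linear growth of the price in the deterministic bubble regime: Suppose ν S(x₅) = μ + x₅ for a real number x₅ > 0, and suppose that P(t) - P(t-1) > x₅ for all t ∈ [t₀ - 1, t₀]. Then for every t ≥ t₀ and every natural number n ≥ 1, P(t + n) > P(t) + n·x₅; in particular P(t) → ∞ as t → ∞. -/
/-- **Linear growth of the price in the deterministic bubble regime.**
Suppose `ν S x₅ = μ + x₅` with `x₅ > 0`, and `P t - P (t-1) > x₅` for all
`t ∈ [t₀ - 1, t₀]`. Then for every `t ≥ t₀` and every natural number `n ≥ 1`,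
`P (t + n) > P t + n x₅`; in particular `P t → ∞` as `t → ∞`. -/
theorem deterministic_bubble_linear_growth
    (μ ν P₀ t₀ x₅ : ℝ) (S P : ℝ → ℝ)
    (hμ : 0 < μ) (hν : 0 < ν)
    (hSodd : ∀ x, S (-x) = -S x) (hSmono : StrictMono S)
    (hP : ∀ t : ℝ, HasDerivAt P (-μ * (1 - Real.exp (P₀ - P t)) + ν * S (P t - P (t - 1))) t)
    (hx₅ : 0 < x₅) (hroot : ν * S x₅ = μ + x₅)
    (hinit : ∀ t ∈ Set.Icc (t₀ - 1) t₀, x₅ < P t - P (t - 1)) :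
    (∀ t, t₀ ≤ t → ∀ n : ℕ, 1 ≤ n → P t + n * x₅ < P (t + n)) ∧
      Filter.Tendsto P Filter.atTop Filter.atTop := by
  have hd : ∀ t, x₅ < P t - P (t - 1) →
      x₅ < -μ * (1 - Real.exp (P₀ - P t)) + ν * S (P t - P (t - 1)) := by
    intro t ht
    have h1 := mul_lt_mul_of_pos_left (hSmono ht) hν
    have h2 := mul_pos hμ (Real.exp_pos (P₀ - P t))
    nlinarith
  have hc : Continuous P := continuous_iff_continuousAt.2 fun t => (hP t).continuousAt
  have mvt : ∀ a b, a < b → (∀ t ∈ Set.Ioo a b, x₅ < P t - P (t - 1)) →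
      x₅ * (b - a) < P b - P a := by
    intro a b hab h
    obtain ⟨c, hcm, he⟩ := exists_hasDerivAt_eq_slope P _ hab hc.continuousOn (fun t _ => hP t)
    have h3 := hd c (h c hcm)
    rw [he, lt_div_iff₀ (by linarith)] at h3
    exact h3
  have key : ∀ t, t₀ - 1 ≤ t → x₅ < P t - P (t - 1) := by
    by_contra! hne
    set A : Set ℝ := {t | t₀ - 1 ≤ t ∧ P t - P (t - 1) ≤ x₅} with hA
    have hAc : IsClosed A :=
      (isClosed_le continuous_const continuous_id).inter
        (isClosed_le (hc.sub (hc.comp (continuous_id.sub continuous_const))) continuous_const)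
    have hAb : BddBelow A := ⟨t₀ - 1, fun t ht => ht.1⟩
    have hT := hAc.csInf_mem hne hAb
    set T := sInf A
    have hT0 : t₀ < T := by
      by_contra! h
      have := hinit T ⟨hT.1, h⟩
      linarith [hT.2]
    have h4 := mvt (T - 1) T (by linarith) (by
      intro t ht
      by_contra! h
      have := csInf_le hAb (show t ∈ A from ⟨by linarith [ht.1], h⟩)
      exact absurd ht.2 (not_lt.2 this))
    linarith [hT.2]
  constructor
  · intro t ht n hn
    have hn' : (1 : ℝ) ≤ n := by exact_mod_cast hn
    have := mvt t (t + n) (by linarith) (fun s hs => key s (by linarith [hs.1]))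
    linarith
  · have hl : Filter.Tendsto (fun t : ℝ => P t₀ + x₅ * (t - t₀)) Filter.atTop Filter.atTop :=
      Filter.tendsto_atTop_add_const_left _ _
        ((Filter.tendsto_atTop_add_const_right _ (-t₀) Filter.tendsto_id).const_mul_atTop hx₅)
    refine Filter.tendsto_atTop_mono' _ ?_ hl
    filter_upwards [Filter.eventually_gt_atTop t₀] with t ht
    have := mvt t₀ t ht (fun s hs => key s (by linarith [hs.1]))
    linarith
end

section
/- Asymptotic growth rate of the deterministic bubble: Suppose S is continuous and the root structure of Assumption II holds: 0 < x₅ < x₆, ν S(x₅) = μ + x₅, ν S(x₆) = μ + x₆, ν S(x) > μ + x for all x ∈ (x₅, x₆), and ν S(x) < μ + x for all x > x₆. Suppose that P(t) - P(t-1) > x₅ for all t ∈ [t₀ - 1, t₀]. Then P'(t) → x₆ as t → ∞. -/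
lemma first_crossing (f : ℝ → ℝ) (hf : Continuous f) (s : ℝ)
    (h0 : ∀ t ∈ Set.Icc (s - 1) s, 0 < f t)
    (hstep : ∀ T, s < T → (∀ t, s - 1 ≤ t → t < T → 0 < f t) → 0 < f T) :
    ∀ t, s - 1 ≤ t → 0 < f t := by
  by_contra! hcon
  obtain ⟨u, hu, hfu⟩ := hcon
  have hsu : s ≤ u := by
    by_contra hlt
    have := h0 u ⟨hu, by linarith⟩
    linarith
  set A : Set ℝ := {t | s ≤ t ∧ f t ≤ 0} with hA
  have hAc : IsClosed A :=
    (isClosed_le continuous_const continuous_id).inter (isClosed_le hf continuous_const)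
  have hAb : BddBelow A := ⟨s, fun t ht => ht.1⟩
  have hmem : sInf A ∈ A := hAc.csInf_mem ⟨u, hsu, hfu⟩ hAb
  have hne : s ≠ sInf A := by
    intro h
    have h1 := h0 s ⟨by linarith, le_refl _⟩
    have h2 := hmem.2
    rw [← h] at h2
    linarith
  have hlt : s < sInf A := lt_of_le_of_ne hmem.1 hne
  have := hstep (sInf A) hlt (by
    intro t ht1 ht2
    by_contra hle
    rcases le_total t s with hts | hts
    · exact hle (h0 t ⟨ht1, hts⟩)
    · have : sInf A ≤ t := csInf_le hAb ⟨hts, by linarith⟩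
      linarith)
  have h2 := hmem.2
  linarith

lemma mvt_real (f f' : ℝ → ℝ) (hf : ∀ t, HasDerivAt f (f' t) t) (a b : ℝ) (hab : a < b) :
    ∃ c, a < c ∧ c < b ∧ f b - f a = f' c * (b - a) := by
  obtain ⟨c, hc, h⟩ := exists_hasDerivAt_eq_slope f f' hab
    (fun x _ => (hf x).continuousAt.continuousWithinAt) (fun x _ => hf x)
  refine ⟨c, hc.1, hc.2, ?_⟩
  rw [h]
  have : b - a ≠ 0 := by linarith
  field_simp

set_option maxHeartbeats 1000000 in
/-- **Asymptotic growth rate of the deterministic bubble.**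
Under the root structure of Assumption II (`0 < x₅ < x₆`, `ν S x₅ = μ + x₅`,
`ν S x₆ = μ + x₆`, `ν S x > μ + x` on `(x₅, x₆)`, `ν S x < μ + x` for `x > x₆`),
if `P t - P (t-1) > x₅` for all `t ∈ [t₀ - 1, t₀]`, then `P'(t) → x₆` as `t → ∞`. -/
theorem deterministic_bubble_asymptotic_rate
    (μ ν P₀ t₀ x₅ x₆ : ℝ) (S P : ℝ → ℝ)
    (hμ : 0 < μ) (hν : 0 < ν)
    (hSodd : ∀ x, S (-x) = -S x) (hSmono : StrictMono S) (hScont : Continuous S)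
    (hP : ∀ t : ℝ, HasDerivAt P (-μ * (1 - Real.exp (P₀ - P t)) + ν * S (P t - P (t - 1))) t)
    (hPC1 : Continuous (deriv P))
    (hx₅ : 0 < x₅) (h₅₆ : x₅ < x₆)
    (hroot₅ : ν * S x₅ = μ + x₅) (hroot₆ : ν * S x₆ = μ + x₆)
    (hmid : ∀ x, x₅ < x → x < x₆ → μ + x < ν * S x)
    (habove : ∀ x, x₆ < x → ν * S x < μ + x)
    (hinit : ∀ t ∈ Set.Icc (t₀ - 1) t₀, x₅ < P t - P (t - 1)) :
    Filter.Tendsto (deriv P) Filter.atTop (nhds x₆) := by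
  have hd : ∀ t, deriv P t = -μ * (1 - Real.exp (P₀ - P t)) + ν * S (P t - P (t - 1)) :=
    fun t => (hP t).deriv
  have hP' : ∀ t, HasDerivAt P (deriv P t) t := fun t => by rw [hd]; exact hP t
  have hPc : Continuous P := continuous_iff_continuousAt.2 fun t => (hP t).continuousAt
  obtain ⟨g, hg⟩ : ∃ g : ℝ → ℝ, ∀ x, g x = ν * S x - μ := ⟨_, fun _ => rfl⟩
  obtain ⟨D, hD⟩ : ∃ D : ℝ → ℝ, ∀ t, D t = P t - P (t - 1) := ⟨_, fun _ => rfl⟩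
  obtain ⟨e, he⟩ : ∃ e : ℝ → ℝ, ∀ t, e t = μ * Real.exp (P₀ - P t) := ⟨_, fun _ => rfl⟩
  have hy : ∀ t, deriv P t = g (D t) + e t := fun t => by rw [hd, hg, hD, he]; ring
  have hepos : ∀ t, 0 < e t := fun t => by rw [he]; positivity
  have hgc : Continuous g := by
    have : g = fun x => ν * S x - μ := funext hg
    rw [this]; fun_prop
  have hDc : Continuous D := by
    have : D = fun x => P x - P (x - 1) := funext hD
    rw [this]; fun_prop
  have hgm : StrictMono g := by
    intro a b hab
    rw [hg, hg]
    have := mul_lt_mul_of_pos_left (hSmono hab) hν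
    linarith
  have hg5 : g x₅ = x₅ := by rw [hg]; linarith
  have hg6 : g x₆ = x₆ := by rw [hg]; linarith
  have hgmid : ∀ x, x₅ < x → x < x₆ → x < g x := fun x h1 h2 => by
    rw [hg]; linarith [hmid x h1 h2]
  have hgab : ∀ x, x₆ < x → g x < x := fun x h1 => by rw [hg]; linarith [habove x h1]
  have hmvt : ∀ T, ∃ c, T - 1 < c ∧ c < T ∧ D T = deriv P c := fun T => by
    obtain ⟨c, h1, h2, h3⟩ := mvt_real P (deriv P) hP' (T - 1) T (by linarith)
    refine ⟨c, h1, h2, ?_⟩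
    rw [hD, h3]; ring
  have hinit' : ∀ t ∈ Set.Icc (t₀ - 1) t₀, x₅ < D t := fun t ht => by
    rw [hD]; exact hinit t ht
  -- invariance of lower bounds
  have hinv : ∀ m, m ≤ g m → (∀ t ∈ Set.Icc (t₀ - 1) t₀, m < D t) →
      ∀ t, t₀ - 1 ≤ t → m < D t := by
    intro m hm hw t ht
    have := first_crossing (fun t => D t - m) (by fun_prop) t₀
      (fun t ht => by have := hw t ht; linarith)
      (by
        intro T hT hb
        obtain ⟨c, h1, h2, h3⟩ := hmvt T
        have h4 := hb c (by linarith) h2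
        have h5 : g m < g (D c) := hgm (by linarith)
        rw [h3, hy]
        linarith [hepos c]) t ht
    linarith
  have hlow5 := hinv x₅ hg5.ge hinit'
  have hy5 : ∀ t, t₀ - 1 ≤ t → x₅ < deriv P t := fun t ht => by
    have := hgm (hlow5 t ht)
    rw [hy]; linarith [hepos t]
  -- better lower bound
  obtain ⟨m, hm5, hm6, hmD⟩ : ∃ m, x₅ < m ∧ m < x₆ ∧ ∀ t, t₀ - 1 ≤ t → m < D t := by
    obtain ⟨u, hu, hmin⟩ := isCompact_Icc.exists_isMinOn
      (Set.nonempty_Icc.2 (by linarith : t₀ - 1 ≤ t₀)) hDc.continuousOn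
    have h5u := hinit' u hu
    obtain ⟨m, h1, h2⟩ := exists_between (lt_min h5u h₅₆)
    have hmu := lt_of_lt_of_le h2 (min_le_left _ _)
    have hm6 := lt_of_lt_of_le h2 (min_le_right _ _)
    exact ⟨m, h1, hm6, hinv m (hgmid m h1 hm6).le fun t ht => lt_of_lt_of_le hmu (hmin ht)⟩
  -- decay of e
  have heb : ∀ t, t₀ ≤ t → e t ≤ e t₀ * Real.exp (-x₅ * (t - t₀)) := by
    intro t ht
    have hPt : P t₀ + x₅ * (t - t₀) ≤ P t := by
      rcases eq_or_lt_of_le ht with h | h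
      · rw [← h]; linarith
      · obtain ⟨c, h1, h2, h3⟩ := mvt_real P (deriv P) hP' t₀ t h
        have := mul_le_mul_of_nonneg_right (hy5 c (by linarith)).le (by linarith : 0 ≤ t - t₀)
        linarith
    rw [he, he, mul_assoc, ← Real.exp_add]
    apply mul_le_mul_of_nonneg_left _ hμ.le
    apply Real.exp_le_exp.2
    linarith
  have he0 : Filter.Tendsto e Filter.atTop (nhds 0) := by
    have h1 : Filter.Tendsto (fun t => e t₀ * Real.exp (-x₅ * (t - t₀))) Filter.atTop
        (nhds (e t₀ * 0)) := by
      apply Filter.Tendsto.const_mul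
      apply Real.tendsto_exp_atBot.comp
      apply Filter.Tendsto.const_mul_atTop_of_neg (by linarith)
      exact Filter.tendsto_atTop_add_const_right _ (-t₀) Filter.tendsto_id
    rw [mul_zero] at h1
    refine squeeze_zero' (Filter.Eventually.of_forall fun t => (hepos t).le) ?_ h1
    filter_upwards [Filter.eventually_ge_atTop t₀] with t ht using heb t ht
  -- upper bound
  obtain ⟨C, hC⟩ : ∃ C, ∀ t, t₀ - 1 ≤ t → deriv P t ≤ C := by
    obtain ⟨u, hu, hmax⟩ := isCompact_Icc.exists_isMaxOn
      (Set.nonempty_Icc.2 (by linarith : t₀ - 1 ≤ t₀)) hPC1.continuousOn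
    obtain ⟨A, hA⟩ : ∃ A, A = e t₀ := ⟨_, rfl⟩
    have hApos : 0 < A := by rw [hA]; exact hepos _
    obtain ⟨K, hK⟩ : ∃ K, K = 4 * A / x₅ := ⟨_, rfl⟩
    have hKpos : 0 < K := by rw [hK]; positivity
    have hKA : K * x₅ = 4 * A := by rw [hK]; field_simp
    obtain ⟨C, hCdef⟩ : ∃ C, C = max (x₆ + A + K) (deriv P u + K * Real.exp x₅) + 1 := ⟨_, rfl⟩
    have hC1 : x₆ + A + K < C := by
      have := le_max_left (x₆ + A + K) (deriv P u + K * Real.exp x₅); linarith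
    have hC2 : deriv P u + K * Real.exp x₅ < C := by
      have := le_max_right (x₆ + A + K) (deriv P u + K * Real.exp x₅); linarith
    obtain ⟨E, hE⟩ : ∃ E : ℝ → ℝ, ∀ t, E t = Real.exp (-x₅ * (t - t₀)) := ⟨_, fun _ => rfl⟩
    have hEpos : ∀ t, 0 < E t := fun t => by rw [hE]; positivity
    have hEc : Continuous E := by
      have : E = fun t => Real.exp (-x₅ * (t - t₀)) := funext hE
      rw [this]; fun_prop
    have hEd : ∀ t, HasDerivAt E (-x₅ * E t) t := fun t => by
      have h1 : HasDerivAt (fun t => -x₅ * (t - t₀)) (-x₅ * 1) t :=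
        ((hasDerivAt_id t).sub_const t₀).const_mul (-x₅)
      have h2 := h1.exp
      rw [show E = fun t => Real.exp (-x₅ * (t - t₀)) from funext hE]
      convert h2 using 1
      ring
    have hWd : ∀ t, HasDerivAt (fun t => C * t + K / x₅ * E t - P t)
        (C - K * E t - deriv P t) t := fun t => by
      have h := (((hasDerivAt_id t).const_mul C).add ((hEd t).const_mul (K / x₅))).sub (hP' t)
      have h8 : K / x₅ * (-x₅ * E t) = -(K * E t) := by field_simp
      rw [h8] at h
      exact h.congr_deriv (by ring)
    have key := first_crossing (fun t => C - K * E t - deriv P t) (by fun_prop) t₀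
      (by
        intro t ht
        have h1 : deriv P t ≤ deriv P u := hmax ht
        have h2 : E t ≤ Real.exp x₅ := by
          rw [hE]; apply Real.exp_le_exp.2; nlinarith [ht.1]
        have := mul_le_mul_of_nonneg_left h2 hKpos.le
        linarith)
      (by
        intro T hT hb
        obtain ⟨c, h1, h2, h3⟩ := mvt_real _ _ hWd (T - 1) T (by linarith)
        have h4 := hb c (by linarith) h2
        have hEs : E (T - 1) = E T * Real.exp x₅ := by
          rw [hE, hE, ← Real.exp_add]; congr 1; ring
        have hq : 1 + x₅ + x₅ ^ 2 / 2 ≤ Real.exp x₅ := Real.quadratic_le_exp_of_nonneg hx₅.le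
        have hE1 : E T ≤ 1 := by
          rw [hE]; apply Real.exp_le_one_iff.2; nlinarith
        have heT : e T ≤ A * E T := by rw [hA, hE]; exact heb T hT.le
        have hDT : D T ≤ C - K / x₅ * (E T * Real.exp x₅ - E T) := by
          rw [hD, ← hEs]
          have h10 : C * T + K / x₅ * E T - P T
              - (C * (T - 1) + K / x₅ * E (T - 1) - P (T - 1)) > 0 := by
            rw [h3]; exact mul_pos h4 (by linarith)
          linarith
        have h6 : K / x₅ * (E T * (x₅ + x₅ ^ 2 / 2)) ≤ K / x₅ * (E T * Real.exp x₅ - E T) := by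
          apply mul_le_mul_of_nonneg_left _ (by positivity)
          have h11 := mul_le_mul_of_nonneg_left hq (hEpos T).le
          linarith
        have h7 : K / x₅ * (E T * (x₅ + x₅ ^ 2 / 2)) = K * E T + 2 * A * E T := by
          have : K / x₅ * (E T * (x₅ + x₅ ^ 2 / 2)) = K * E T + K * x₅ * E T / 2 := by
            field_simp
          rw [this, hKA]; ring
        have hAE : 0 < A * E T := mul_pos hApos (hEpos T)
        rw [hy]
        rcases le_or_gt (D T) x₆ with h | h
        · have := hgm.monotone h
          have hAE1 : A * E T ≤ A := mul_le_of_le_one_right hApos.le hE1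
          have hKE1 : K * E T ≤ K := mul_le_of_le_one_right hKpos.le hE1
          linarith
        · have := hgab _ h
          linarith)
    refine ⟨C, fun t ht => ?_⟩
    have := key t ht
    have h9 := mul_pos hKpos (hEpos t)
    linarith
  -- limsup
  have hup : ∀ b, x₆ < b → ∀ᶠ t in Filter.atTop, D t < b := by
    set A : Set ℝ := {a | ∀ᶠ t in Filter.atTop, D t ≤ a} with hA
    have hbd : BddBelow A := by
      refine ⟨x₅, fun a ha => ?_⟩
      obtain ⟨t, h1, h2⟩ := (ha.and (Filter.eventually_ge_atTop (t₀ - 1))).exists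
      linarith [hlow5 t h2]
    have hne : A.Nonempty := by
      refine ⟨C, ?_⟩
      filter_upwards [Filter.eventually_ge_atTop t₀] with t ht
      obtain ⟨c, h1, h2, h3⟩ := hmvt t
      rw [h3]; exact hC c (by linarith)
    have hgt : ∀ a, sInf A < a → a ∈ A := by
      intro a ha
      obtain ⟨a', h1, h2⟩ := exists_lt_of_csInf_lt hne ha
      exact Filter.Eventually.mono h1 fun t ht => by linarith
    have hle : sInf A ≤ x₆ := by
      by_contra! hlt
      obtain ⟨b, hb1, hb2⟩ := exists_between (hgab _ hlt)
      obtain ⟨b', hb'1, hb'2⟩ := exists_between hb1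
      have hnear : ∀ᶠ a in nhdsWithin (sInf A) (Set.Ioi (sInf A)), g a < b' :=
        (hgc.continuousAt.continuousWithinAt).eventually (gt_mem_nhds hb'1)
      obtain ⟨a, ha1, ha2⟩ := (hnear.and self_mem_nhdsWithin).exists
      have haA := hgt a ha2
      have hev : ∀ᶠ t in Filter.atTop, deriv P t ≤ b := by
        filter_upwards [haA, he0.eventually (gt_mem_nhds (by linarith : (0:ℝ) < b - b'))]
          with t h1 h2
        have := hgm.monotone h1
        rw [hy]; linarith
      obtain ⟨N, hN⟩ := Filter.eventually_atTop.1 hev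
      have hbA : b ∈ A := by
        filter_upwards [Filter.eventually_ge_atTop (N + 1)] with t ht
        obtain ⟨c, h1, h2, h3⟩ := hmvt t
        rw [h3]; exact hN c (by linarith)
      linarith [csInf_le hbd hbA]
    intro b hb
    obtain ⟨a, h1, h2⟩ := exists_between hb
    exact Filter.Eventually.mono (hgt a (by linarith)) fun t ht => by linarith
  have hlo : ∀ b, b < x₆ → ∀ᶠ t in Filter.atTop, b < D t := by
    set A : Set ℝ := {a | a ≤ x₆ ∧ ∀ᶠ t in Filter.atTop, a ≤ D t} with hA
    have hbd : BddAbove A := ⟨x₆, fun a ha => ha.1⟩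
    have hmA : m ∈ A := by
      refine ⟨hm6.le, ?_⟩
      filter_upwards [Filter.eventually_ge_atTop (t₀ - 1)] with t ht using (hmD t ht).le
    have hgt : ∀ a, a < sSup A → ∀ᶠ t in Filter.atTop, a ≤ D t := by
      intro a ha
      obtain ⟨a', h1, h2⟩ := exists_lt_of_lt_csSup ⟨m, hmA⟩ ha
      exact Filter.Eventually.mono h1.2 fun t ht => by linarith
    have hle : x₆ ≤ sSup A := by
      by_contra! hlt
      have hms := le_csSup hbd hmA
      obtain ⟨b, hb1, hb2⟩ := exists_between (lt_min (hgmid _ (by linarith) hlt) hlt)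
      have hbg := lt_of_lt_of_le hb2 (min_le_left _ _)
      have hb6 := lt_of_lt_of_le hb2 (min_le_right _ _)
      have hnear : ∀ᶠ a in nhdsWithin (sSup A) (Set.Iio (sSup A)), b < g a :=
        (hgc.continuousAt.continuousWithinAt).eventually (lt_mem_nhds hbg)
      obtain ⟨a, ha1, ha2⟩ := (hnear.and self_mem_nhdsWithin).exists
      have haA := hgt a ha2
      have hev : ∀ᶠ t in Filter.atTop, b ≤ deriv P t := by
        filter_upwards [haA] with t h1
        have := hgm.monotone h1
        rw [hy]; linarith [hepos t]
      obtain ⟨N, hN⟩ := Filter.eventually_atTop.1 hev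
      have hbA : b ∈ A := by
        refine ⟨hb6.le, ?_⟩
        filter_upwards [Filter.eventually_ge_atTop (N + 1)] with t ht
        obtain ⟨c, h1, h2, h3⟩ := hmvt t
        rw [h3]; exact hN c (by linarith)
      linarith [le_csSup hbd hbA]
    intro b hb
    obtain ⟨a, h1, h2⟩ := exists_between hb
    exact Filter.Eventually.mono (hgt a (by linarith)) fun t ht => by linarith
  have hDlim : Filter.Tendsto D Filter.atTop (nhds x₆) := tendsto_order.2 ⟨hlo, hup⟩
  have hfin := ((hgc.tendsto x₆).comp hDlim).add he0
  rw [hg6, add_zero] at hfin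
  exact hfin.congr fun t => (hy t).symm
end

section
/- Monotonicity of the minimal growth rate below x₆ in the deterministic bubble regime: Suppose the root structure of Assumption II holds (0 < x₅ < x₆, ν S(x₅) = μ + x₅, ν S(x₆) = μ + x₆, ν S(x) > μ + x for x ∈ (x₅, x₆), ν S(x) < μ + x for x > x₆), and P(t) - P(t-1) > x₅ for all t ∈ [t₀ - 1, t₀]. Define p_n⁻ = min over t ∈ [t₀ + n - 1, t₀ + n] of P'(t). Then for every natural number n ≥ 1, if p_n⁻ ≤ x₆ then p_{n+1}⁻ ≥ p_n⁻. -/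
/-- **Monotonicity of the minimal growth rate below `x₆` in the deterministic bubble
regime.** Under the root structure of Assumption II, if `P t - P (t-1) > x₅` for all
`t ∈ [t₀ - 1, t₀]`, and `p n` denotes the minimum of `P'` over `[t₀ + n - 1, t₀ + n]`,
then for every `n ≥ 1`, `p n ≤ x₆` implies `p (n+1) ≥ p n`. -/
theorem deterministic_bubble_min_rate_monotone
    (μ ν P₀ t₀ x₅ x₆ : ℝ) (S P : ℝ → ℝ)
    (hμ : 0 < μ) (hν : 0 < ν)
    (hSodd : ∀ x, S (-x) = -S x) (hSmono : StrictMono S) (hScont : Continuous S)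
    (hP : ∀ t : ℝ, HasDerivAt P (-μ * (1 - Real.exp (P₀ - P t)) + ν * S (P t - P (t - 1))) t)
    (hPC1 : Continuous (deriv P))
    (hx₅ : 0 < x₅) (h₅₆ : x₅ < x₆)
    (hroot₅ : ν * S x₅ = μ + x₅) (hroot₆ : ν * S x₆ = μ + x₆)
    (hmid : ∀ x, x₅ < x → x < x₆ → μ + x < ν * S x)
    (habove : ∀ x, x₆ < x → ν * S x < μ + x)
    (hinit : ∀ t ∈ Set.Icc (t₀ - 1) t₀, x₅ < P t - P (t - 1))
    (p : ℕ → ℝ)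
    (hp : ∀ n : ℕ, IsLeast (deriv P '' Set.Icc (t₀ + (n : ℝ) - 1) (t₀ + (n : ℝ))) (p n)) :
    ∀ n : ℕ, 1 ≤ n → p n ≤ x₆ → p n ≤ p (n + 1) := by
  have hd : ∀ t, deriv P t = -μ * (1 - Real.exp (P₀ - P t)) + ν * S (P t - P (t - 1)) :=
    fun t => (hP t).deriv
  have hdiff : Differentiable ℝ P := fun t => (hP t).differentiableAt
  -- mean value theorem on [t-1,t]
  have hmvt : ∀ t, ∃ c, t - 1 < c ∧ c < t ∧ deriv P c = P t - P (t - 1) := by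
    intro t
    obtain ⟨c, hc, h⟩ := exists_deriv_eq_slope P (show t - 1 < t by linarith)
      hdiff.continuous.continuousOn hdiff.differentiableOn
    refine ⟨c, hc.1, hc.2, ?_⟩
    rw [h]
    simp
  -- lower bound for the derivative
  have hlow : ∀ t m, m ≤ P t - P (t - 1) → ν * S m - μ < deriv P t := by
    intro t m hm
    have h1 : ν * S m ≤ ν * S (P t - P (t - 1)) :=
      mul_le_mul_of_nonneg_left (hSmono.monotone hm) hν.le
    have h2 := mul_pos hμ (Real.exp_pos (P₀ - P t))
    rw [hd t]
    nlinarith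
  have hx : ∀ t, t₀ - 1 ≤ t → x₅ < deriv P t := by
    by_contra hcon
    push Not at hcon
    obtain ⟨s, hs1, hs2⟩ := hcon
    let A : Set ℝ := {t | t₀ - 1 ≤ t ∧ deriv P t ≤ x₅}
    have hA : IsClosed A :=
      (isClosed_le continuous_const continuous_id).inter (isClosed_le hPC1 continuous_const)
    have hb : BddBelow A := ⟨t₀ - 1, fun t ht => ht.1⟩
    have hT : sInf A ∈ A := hA.csInf_mem ⟨s, hs1, hs2⟩ hb
    generalize hTe : sInf A = T at hT
    obtain ⟨hT1, hT2⟩ := hT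
    have key : x₅ < P T - P (T - 1) := by
      by_cases h : T ≤ t₀
      · exact hinit T ⟨hT1, h⟩
      · push Not at h
        obtain ⟨c, hc1, hc2, hc⟩ := hmvt T
        rw [← hc]
        by_contra hle
        have : sInf A ≤ c := csInf_le hb ⟨by linarith, not_lt.mp hle⟩
        linarith
    have := hlow T x₅ key.le
    linarith
  intro n _ hn
  by_contra hlt
  push Not at hlt
  obtain ⟨⟨t, ht, hpt⟩, hmin⟩ := hp (n + 1)
  have hmin0 := (hp n).2
  push_cast at ht hmin
  have hn0 : (0 : ℝ) ≤ n := Nat.cast_nonneg n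
  obtain ⟨c, hc1, hc2, hc⟩ := hmvt t
  have hcge : p (n + 1) ≤ deriv P c := by
    by_cases h : c ≤ t₀ + n
    · exact hlt.le.trans (hmin0 ⟨c, ⟨by linarith [ht.1], h⟩, rfl⟩)
    · push Not at h
      exact hmin ⟨c, ⟨by linarith, by linarith [ht.2]⟩, rfl⟩
  have h1 := hlow t (p (n + 1)) (hc ▸ hcge)
  have h2 := hmid (p (n + 1)) (hpt ▸ hx t (by linarith [ht.1])) (by linarith)
  linarith
end

section
/- Absorption above x₆ of the minimal growth rate in the deterministic bubble regime: Suppose the root structure of Assumption II holds (0 < x₅ < x₆, ν S(x₅) = μ + x₅, ν S(x₆) = μ + x₆, ν S(x) > μ + x for x ∈ (x₅, x₆), ν S(x) < μ + x for x > x₆), and P(t) - P(t-1) > x₅ for all t ∈ [t₀ - 1, t₀]. Define p_n⁻ = min over t ∈ [t₀ + n - 1, t₀ + n] of P'(t). Then for all natural numbers k ≤ n with k ≥ 1, if p_k⁻ ≥ x₆ then p_n⁻ ≥ x₆. -/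
/-- **Absorption above `x₆` of the minimal growth rate in the deterministic bubble
regime.** Under the root structure of Assumption II, if `P t - P (t-1) > x₅` for all
`t ∈ [t₀ - 1, t₀]`, and `p n` denotes the minimum of `P'` over `[t₀ + n - 1, t₀ + n]`,
then for all `1 ≤ k ≤ n`, `p k ≥ x₆` implies `p n ≥ x₆`. -/
theorem deterministic_bubble_min_rate_absorbed
    (μ ν P₀ t₀ x₅ x₆ : ℝ) (S P : ℝ → ℝ)
    (hμ : 0 < μ) (hν : 0 < ν)
    (hSodd : ∀ x, S (-x) = -S x) (hSmono : StrictMono S) (hScont : Continuous S)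
    (hP : ∀ t : ℝ, HasDerivAt P (-μ * (1 - Real.exp (P₀ - P t)) + ν * S (P t - P (t - 1))) t)
    (hPC1 : Continuous (deriv P))
    (hx₅ : 0 < x₅) (h₅₆ : x₅ < x₆)
    (hroot₅ : ν * S x₅ = μ + x₅) (hroot₆ : ν * S x₆ = μ + x₆)
    (hmid : ∀ x, x₅ < x → x < x₆ → μ + x < ν * S x)
    (habove : ∀ x, x₆ < x → ν * S x < μ + x)
    (hinit : ∀ t ∈ Set.Icc (t₀ - 1) t₀, x₅ < P t - P (t - 1))
    (p : ℕ → ℝ)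
    (hp : ∀ n : ℕ, IsLeast (deriv P '' Set.Icc (t₀ + (n : ℝ) - 1) (t₀ + (n : ℝ))) (p n)) :
    ∀ k n : ℕ, 1 ≤ k → k ≤ n → x₆ ≤ p k → x₆ ≤ p n := by
  intro k n hk hkn hpk
  have hd : Differentiable ℝ P := fun t => (hP t).differentiableAt
  have hbase : ∀ s ∈ Set.Icc (t₀ + (k : ℝ) - 1) (t₀ + (k : ℝ)), x₆ ≤ deriv P s :=
    fun s hs => hpk.trans ((hp k).2 ⟨s, hs, rfl⟩)
  have key : ∀ s, t₀ + (k : ℝ) ≤ s → x₆ ≤ deriv P s := by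
    by_contra! hcon
    obtain ⟨s₀, hs₀, hs₀'⟩ := hcon
    set B : Set ℝ := {s | t₀ + (k : ℝ) ≤ s ∧ deriv P s < x₆} with hB
    have hne : B.Nonempty := ⟨s₀, hs₀, hs₀'⟩
    have hbdd : BddBelow B := ⟨t₀ + (k : ℝ), fun s hs => hs.1⟩
    set τ := sInf B with hτ
    have haτ : t₀ + (k : ℝ) ≤ τ := le_csInf hne fun s hs => hs.1
    have hbelow : ∀ u, t₀ + (k : ℝ) - 1 ≤ u → u < τ → x₆ ≤ deriv P u := by
      intro u h1 h2
      by_cases h3 : u ≤ t₀ + (k : ℝ)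
      · exact hbase u ⟨h1, h3⟩
      · by_contra! h4
        exact absurd (csInf_le hbdd (show u ∈ B from ⟨(not_le.mp h3).le, h4⟩)) (not_le.mpr h2)
    have hΔ : x₆ ≤ P τ - P (τ - 1) := by
      have := (convex_Icc (τ - 1) τ).mul_sub_le_image_sub_of_le_deriv
        hd.continuous.continuousOn hd.differentiableOn (C := x₆)
        (by
          intro u hu
          rw [interior_Icc] at hu
          exact hbelow u (by linarith [hu.1]) hu.2)
        (τ - 1) ⟨le_rfl, by linarith⟩ τ ⟨by linarith, le_rfl⟩ (by linarith)
      linarith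
    have hτd : x₆ < deriv P τ := by
      rw [(hP τ).deriv]
      have h1 : ν * S x₆ ≤ ν * S (P τ - P (τ - 1)) :=
        mul_le_mul_of_nonneg_left (hSmono.monotone hΔ) hν.le
      have h2 : 0 < μ * Real.exp (P₀ - P τ) := mul_pos hμ (Real.exp_pos _)
      linarith
    obtain ⟨ε, hε, hball⟩ := Metric.eventually_nhds_iff.mp
      (hPC1.continuousAt.eventually (lt_mem_nhds hτd))
    obtain ⟨s, hs, hsτ⟩ := exists_lt_of_csInf_lt hne (show sInf B < τ + ε by linarith)
    have hτs : τ ≤ s := csInf_le hbdd hs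
    have := hball (y := s) (by rw [Real.dist_eq, abs_of_nonneg (by linarith)]; linarith)
    exact absurd hs.2 (not_lt.mpr this.le)
  obtain ⟨s, hs, hsp⟩ := (hp n).1
  rw [← hsp]
  have hkn' : (k : ℝ) ≤ n := by exact_mod_cast hkn
  by_cases h : s ≤ t₀ + (k : ℝ)
  · exact hbase s ⟨by linarith [hs.1], h⟩
  · exact key s (not_le.mp h).le
end

section
/- Persistence of the deterministic collapse regime: Suppose ν S(x₃) = x₃ for a real number x₃ < 0, and suppose that P(t) - P(t-1) < x₃ and P(t) > P₀ for all t ∈ [t₀ - 1, t₀]. Then for every t > t₀ such that P(s) > P₀ for all s ∈ [t₀, t], one has P(t) - P(t-1) < x₃. -/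
/-- **Persistence of the deterministic collapse regime.**
Suppose `ν S x₃ = x₃` with `x₃ < 0`, and that `P t - P (t-1) < x₃` and `P t > P₀`
for all `t ∈ [t₀ - 1, t₀]`. Then for every `t > t₀` such that `P s > P₀` for all
`s ∈ [t₀, t]`, one has `P t - P (t-1) < x₃`. -/
theorem deterministic_collapse_persistence
    (μ ν P₀ t₀ x₃ : ℝ) (S P : ℝ → ℝ)
    (hμ : 0 < μ) (hν : 0 < ν)
    (hSodd : ∀ x, S (-x) = -S x) (hSmono : StrictMono S)
    (hP : ∀ t : ℝ, HasDerivAt P (-μ * (1 - Real.exp (P₀ - P t)) + ν * S (P t - P (t - 1))) t)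
    (hx₃ : x₃ < 0) (hroot : ν * S x₃ = x₃)
    (hinit : ∀ t ∈ Set.Icc (t₀ - 1) t₀, P t - P (t - 1) < x₃ ∧ P₀ < P t) :
    ∀ t, t₀ < t → (∀ s ∈ Set.Icc t₀ t, P₀ < P s) → P t - P (t - 1) < x₃ := by
  intro t ht hpos
  by_contra hcon
  have hcon' : x₃ ≤ P t - P (t - 1) := not_lt.mp hcon
  have hPc : Continuous P := continuous_iff_continuousAt.mpr fun s => (hP s).continuousAt
  have hDc : Continuous fun s => P s - P (s - 1) := by fun_prop
  have hK : IsCompact (Set.Icc t₀ t ∩ {s | x₃ ≤ P s - P (s - 1)}) :=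
    isCompact_Icc.inter_right (isClosed_le continuous_const hDc)
  obtain ⟨τ, ⟨⟨h1, h2⟩, h3⟩, hmin⟩ := hK.exists_isLeast ⟨t, ⟨ht.le, le_refl t⟩, hcon'⟩
  have h3' : x₃ ≤ P τ - P (τ - 1) := h3
  obtain ⟨c, ⟨hc1, hc2⟩, hc⟩ := exists_hasDerivAt_eq_slope P _ (show τ - 1 < τ by linarith)
    hPc.continuousOn (fun s _ => hP s)
  have key : P c - P (c - 1) < x₃ ∧ P₀ < P c := by
    rcases le_total c t₀ with h | h
    · exact hinit c ⟨by linarith, h⟩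
    · refine ⟨?_, hpos c ⟨h, by linarith⟩⟩
      by_contra hh
      have := hmin ⟨⟨h, by linarith⟩, not_lt.mp hh⟩
      linarith
  have hS : ν * S (P c - P (c - 1)) < x₃ := by
    have := hSmono key.1
    calc _ < ν * S x₃ := mul_lt_mul_of_pos_left this hν
      _ = x₃ := hroot
  have hE : Real.exp (P₀ - P c) < 1 := Real.exp_lt_one_iff.mpr (by linarith [key.2])
  have hM : 0 < μ * (1 - Real.exp (P₀ - P c)) := mul_pos hμ (by linarith)
  rw [show τ - (τ - 1) = 1 by ring, div_one] at hc
  linarith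
end

section
/- Acceleration of decay in the deterministic collapse regime: Suppose x₂ < x₃ < 0 satisfy ν S(x₂) = x₂, ν S(x₃) = x₃ and ν S(x) < x for all x ∈ (x₂, x₃). Suppose P(t) > P₀ for all t ∈ [t₀ - 1, t₀ + 1], and the quantity d₀ = max over t ∈ [t₀ - 1, t₀] of (P(t) - P(t-1)) satisfies x₂ < d₀ < x₃. Then d₁ = max over t ∈ [t₀, t₀ + 1] of (P(t) - P(t-1)) satisfies d₁ < d₀. -/
/-- **Acceleration of decay in the deterministic collapse regime.**
Suppose `x₂ < x₃ < 0` satisfy `ν S x₂ = x₂`, `ν S x₃ = x₃` and `ν S x < x` on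
`(x₂, x₃)`. Suppose `P t > P₀` for all `t ∈ [t₀ - 1, t₀ + 1]`, and the maximum `d₀`
of `P t - P (t-1)` over `[t₀ - 1, t₀]` satisfies `x₂ < d₀ < x₃`. Then the maximum
`d₁` of `P t - P (t-1)` over `[t₀, t₀ + 1]` satisfies `d₁ < d₀`. -/
theorem deterministic_collapse_acceleration
    (μ ν P₀ t₀ x₂ x₃ d₀ d₁ : ℝ) (S P : ℝ → ℝ)
    (hμ : 0 < μ) (hν : 0 < ν)
    (hSodd : ∀ x, S (-x) = -S x) (hSmono : StrictMono S)
    (hP : ∀ t : ℝ, HasDerivAt P (-μ * (1 - Real.exp (P₀ - P t)) + ν * S (P t - P (t - 1))) t)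
    (h₂₃ : x₂ < x₃) (hx₃ : x₃ < 0)
    (hroot₂ : ν * S x₂ = x₂) (hroot₃ : ν * S x₃ = x₃)
    (hmid : ∀ x, x₂ < x → x < x₃ → ν * S x < x)
    (hpos : ∀ t ∈ Set.Icc (t₀ - 1) (t₀ + 1), P₀ < P t)
    (hd₀ : IsGreatest ((fun t => P t - P (t - 1)) '' Set.Icc (t₀ - 1) t₀) d₀)
    (hd₁ : IsGreatest ((fun t => P t - P (t - 1)) '' Set.Icc t₀ (t₀ + 1)) d₁)
    (hd₀lo : x₂ < d₀) (hd₀hi : d₀ < x₃) :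
    d₁ < d₀ := by
  by_contra hcon
  have hcon : d₀ ≤ d₁ := not_lt.mp hcon
  have hPc : Continuous P := continuous_iff_continuousAt.mpr fun t => (hP t).continuousAt
  have hDc : Continuous (fun t => P t - P (t - 1)) := by fun_prop
  -- the first time in `[t₀, t₀ + 1]` at which the increment reaches `d₀`
  have hK : IsCompact (Set.Icc t₀ (t₀ + 1) ∩ {t | d₀ ≤ P t - P (t - 1)}) :=
    isCompact_Icc.inter_right (isClosed_le continuous_const hDc)
  have hne : (Set.Icc t₀ (t₀ + 1) ∩ {t | d₀ ≤ P t - P (t - 1)}).Nonempty := by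
    obtain ⟨⟨t, ht, hte⟩, -⟩ := hd₁
    refine ⟨t, ht, ?_⟩
    have hte : P t - P (t - 1) = d₁ := hte
    show d₀ ≤ P t - P (t - 1)
    linarith
  obtain ⟨s, ⟨hsI, hsD⟩, hmin⟩ := hK.exists_isLeast hne
  have hsD : d₀ ≤ P s - P (s - 1) := hsD
  obtain ⟨ξ, hξ, hξe⟩ := exists_hasDerivAt_eq_slope P _ (show s - 1 < s by linarith)
    hPc.continuousOn (fun x _ => hP x)
  have hone : s - (s - 1) = 1 := by ring
  rw [hone, div_one] at hξe
  have hξ1 := hξ.1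
  have hξ2 := hξ.2
  have hs1 := hsI.1
  have hs2 := hsI.2
  have hDξ : P ξ - P (ξ - 1) ≤ d₀ := by
    rcases le_total ξ t₀ with h | h
    · exact hd₀.2 ⟨ξ, ⟨by linarith, h⟩, rfl⟩
    · by_contra hc
      have hle : s ≤ ξ := hmin ⟨⟨h, by linarith⟩, (not_le.mp hc).le⟩
      linarith
  have hSle : ν * S (P ξ - P (ξ - 1)) ≤ ν * S d₀ :=
    mul_le_mul_of_nonneg_left (hSmono.monotone hDξ) hν.le
  have hSd := hmid d₀ hd₀lo hd₀hi
  have hPξ := hpos ξ ⟨by linarith, by linarith⟩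
  have hexp : Real.exp (P₀ - P ξ) < 1 := by rw [← Real.exp_zero]; exact Real.exp_lt_exp.mpr (by linarith)
  have hmul : 0 < μ * (1 - Real.exp (P₀ - P ξ)) := mul_pos hμ (by linarith)
  linarith
end

section
/- A small jump in fundamentals does not ignite a deterministic bubble: Suppose Assumption I' holds with constants δ_m > 0, c_m > 0, that |P(t) - P₋| < δ_m/2 for all t ∈ [t₀ - 1, t₀], and that the fundamental value jumps at t₀ from P₋ to P₊ with 0 < P₊ - P₋ < δ_m/2. Then for all t ∈ [t₀, t₀ + 1] one has -δ_m < P(t) - P₊ < δ_m/2, and for all t > t₀ one has |P(t) - P₊| < δ_m. -/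
lemma left_deriv_nonneg (f : ℝ → ℝ) (f' a b : ℝ) (hab : a < b) (h : HasDerivAt f f' b)
    (hf : ∀ t, a < t → t < b → f t ≤ f b) : 0 ≤ f' := by
  have h1 : HasDerivWithinAt f f' (Set.Iio b) b := h.hasDerivWithinAt
  rw [hasDerivWithinAt_iff_tendsto_slope' (by simp)] at h1
  refine ge_of_tendsto h1 ?_
  filter_upwards [Ioo_mem_nhdsLT hab] with t ht
  rw [slope_def_field]
  have := hf t ht.1 ht.2
  rw [← neg_sub (f b) (f t), ← neg_sub b t, neg_div_neg_eq] at *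
  exact div_nonneg (by linarith) (by linarith [ht.2])

/-- **A small jump in fundamentals does not ignite a deterministic bubble.**
Suppose Assumption I' holds, `|P t - P₋| < δm/2` for all `t ∈ [t₀ - 1, t₀]`, and the
fundamental value jumps at `t₀` from `P₋` to `P₊` with `0 < P₊ - P₋ < δm/2`. Then
for all `t ∈ [t₀, t₀ + 1]`, `-δm < P t - P₊ < δm/2`, and for all `t > t₀`,
`|P t - P₊| < δm`. -/
theorem deterministic_small_jump_no_bubble
    (μ ν Pm Pp t₀ δm cm : ℝ) (S P : ℝ → ℝ)
    (hμ : 0 < μ) (hν : 0 < ν)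
    (hSodd : ∀ x, S (-x) = -S x) (hSmono : StrictMono S)
    (hPcont : Continuous P)
    (hPbefore : ∀ t : ℝ, t < t₀ →
      HasDerivAt P (-μ * (1 - Real.exp (Pm - P t)) + ν * S (P t - P (t - 1))) t)
    (hPafter : ∀ t : ℝ, t₀ < t →
      HasDerivAt P (-μ * (1 - Real.exp (Pp - P t)) + ν * S (P t - P (t - 1))) t)
    (hδm : 0 < δm) (hcm : 0 < cm)
    (hA1 : ∀ x, δm / 4 ≤ x → x ≤ δm →
      -μ * (1 - Real.exp (-x)) + ν * S (x + δm) < -(cm * μ * δm))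
    (hA2 : ∀ x, -δm ≤ x → x ≤ -(δm / 4) →
      cm * μ * δm < -μ * (1 - Real.exp (-x)) + ν * S (x - δm))
    (hinit : ∀ t ∈ Set.Icc (t₀ - 1) t₀, |P t - Pm| < δm / 2)
    (hjump_lo : 0 < Pp - Pm) (hjump_hi : Pp - Pm < δm / 2) :
    (∀ t ∈ Set.Icc t₀ (t₀ + 1), -δm < P t - Pp ∧ P t - Pp < δm / 2) ∧
      (∀ t, t₀ < t → |P t - Pp| < δm) := by
  have key : ∀ t, t₀ - 1 ≤ t → -δm < P t - Pp ∧ P t - Pp < δm / 2 := by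
    by_contra hcon
    let B : Set ℝ := {t | t₀ - 1 ≤ t ∧ (P t - Pp ≤ -δm ∨ δm / 2 ≤ P t - Pp)}
    have hBne : B.Nonempty := by
      push Not at hcon
      obtain ⟨t, ht, h⟩ := hcon
      refine ⟨t, ht, ?_⟩
      by_cases h2 : P t - Pp ≤ -δm
      · exact Or.inl h2
      · exact Or.inr (h (not_le.mp h2))
    have hBc : IsClosed B := by
      have e1 : IsClosed {t : ℝ | t₀ - 1 ≤ t} := isClosed_le continuous_const continuous_id
      have e2 : IsClosed {t : ℝ | P t - Pp ≤ -δm} :=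
        isClosed_le (hPcont.sub continuous_const) continuous_const
      have e3 : IsClosed {t : ℝ | δm / 2 ≤ P t - Pp} :=
        isClosed_le continuous_const (hPcont.sub continuous_const)
      exact e1.inter (e2.union e3)
    have hBb : BddBelow B := ⟨t₀ - 1, fun t ht => ht.1⟩
    have hmem : sInf B ∈ B := hBc.csInf_mem hBne hBb
    have hlow : ∀ t ∈ B, sInf B ≤ t := fun t ht => csInf_le hBb ht
    generalize sInf B = b at hmem hlow
    obtain ⟨hb1, hb2⟩ := hmem
    have hb : t₀ < b := by
      by_contra hle
      have h := abs_lt.mp (hinit b ⟨hb1, not_lt.mp hle⟩)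
      rcases hb2 with h2 | h2 <;> linarith [h.1, h.2]
    have hlt : ∀ t, t₀ - 1 ≤ t → t < b → -δm < P t - Pp ∧ P t - Pp < δm / 2 := by
      intro t ht htb
      constructor
      · by_contra h
        exact absurd (hlow t ⟨ht, Or.inl (not_lt.mp h)⟩) (not_le.mpr htb)
      · by_contra h
        exact absurd (hlow t ⟨ht, Or.inr (not_lt.mp h)⟩) (not_le.mpr htb)
    have htend : Filter.Tendsto P (nhdsWithin b (Set.Iio b)) (nhds (P b)) :=
      (hPcont.tendsto b).mono_left nhdsWithin_le_nhds
    have hprev := hlt (b - 1) (by linarith) (by linarith)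
    have hd := hPafter b hb
    rcases hb2 with h2 | h2
    · have hge : Pp - δm ≤ P b := by
        refine ge_of_tendsto htend ?_
        filter_upwards [Ioo_mem_nhdsLT hb] with t ht
        linarith [(hlt t (by linarith [ht.1]) ht.2).1]
      have hx : P b - Pp = -δm := by linarith
      have h0 := left_deriv_nonneg (fun t => - P t) _ t₀ b hb hd.neg (by
        intro t h1 h3
        have := (hlt t (by linarith) h3).1
        show -P t ≤ -P b
        linarith)
      have hA := hA2 (P b - Pp) (by linarith) (by linarith)
      rw [neg_sub] at hA
      have hS : S (P b - Pp - δm) ≤ S (P b - P (b - 1)) := hSmono.monotone (by linarith [hprev.2])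
      have := mul_le_mul_of_nonneg_left hS hν.le
      have : 0 < cm * μ * δm := by positivity
      linarith
    · have hle : P b ≤ Pp + δm / 2 := by
        refine le_of_tendsto htend ?_
        filter_upwards [Ioo_mem_nhdsLT hb] with t ht
        linarith [(hlt t (by linarith [ht.1]) ht.2).2]
      have h0 := left_deriv_nonneg P _ t₀ b hb hd (by
        intro t h1 h3
        have := (hlt t (by linarith) h3).2
        linarith)
      have hA := hA1 (P b - Pp) (by linarith) (by linarith)
      rw [neg_sub] at hA
      have hS : S (P b - P (b - 1)) ≤ S (P b - Pp + δm) := hSmono.monotone (by linarith [hprev.1])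
      have := mul_le_mul_of_nonneg_left hS hν.le
      have : 0 < cm * μ * δm := by positivity
      linarith
  refine ⟨fun t ht => key t (by linarith [ht.1]), fun t ht => ?_⟩
  have h := key t (by linarith)
  exact abs_lt.mpr ⟨h.1, by linarith [h.2]⟩
end

section
/- Initial growth rate after a large jump in fundamentals (deterministic case): Suppose Assumption I' holds with constants δ_m > 0, c_m > 0, that ν S(x₅) = μ + x₅ with x₅ > 0, that |P(t) - P₋| < δ_m/2 for all t ∈ [t₀ - 1, t₀], and that the fundamental value jumps at t₀ from P₋ to P₊ with P₊ - P₋ ≥ x₅ + x₅/μ + δ_m. Then P'(t) > x₅ for every t ∈ (t₀, t₀ + 1]. -/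
/-- **Initial growth rate after a large jump in fundamentals (deterministic case).**
Suppose Assumption I' holds, `ν S x₅ = μ + x₅` with `x₅ > 0`, `|P t - P₋| < δm/2`
for all `t ∈ [t₀ - 1, t₀]`, and the fundamental value jumps at `t₀` from `P₋` to `P₊`
with `P₊ - P₋ ≥ x₅ + x₅/μ + δm`. Then `P'(t) > x₅` for every `t ∈ (t₀, t₀ + 1]`. -/
theorem deterministic_large_jump_initial_rate
    (μ ν Pm Pp t₀ δm cm x₅ : ℝ) (S P : ℝ → ℝ)
    (hμ : 0 < μ) (hν : 0 < ν)
    (hSodd : ∀ x, S (-x) = -S x) (hSmono : StrictMono S)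
    (hPcont : Continuous P)
    (hPbefore : ∀ t : ℝ, t < t₀ →
      HasDerivAt P (-μ * (1 - Real.exp (Pm - P t)) + ν * S (P t - P (t - 1))) t)
    (hPafter : ∀ t : ℝ, t₀ < t →
      HasDerivAt P (-μ * (1 - Real.exp (Pp - P t)) + ν * S (P t - P (t - 1))) t)
    (hδm : 0 < δm) (hcm : 0 < cm)
    (hA1 : ∀ x, δm / 4 ≤ x → x ≤ δm →
      -μ * (1 - Real.exp (-x)) + ν * S (x + δm) < -(cm * μ * δm))
    (hA2 : ∀ x, -δm ≤ x → x ≤ -(δm / 4) →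
      cm * μ * δm < -μ * (1 - Real.exp (-x)) + ν * S (x - δm))
    (hx₅ : 0 < x₅) (hroot : ν * S x₅ = μ + x₅)
    (hinit : ∀ t ∈ Set.Icc (t₀ - 1) t₀, |P t - Pm| < δm / 2)
    (hjump : x₅ + x₅ / μ + δm ≤ Pp - Pm) :
    ∀ t ∈ Set.Ioc t₀ (t₀ + 1), x₅ < deriv P t := by
  have hS5 : ν * S (5 * δm / 4) < μ * (δm / 4) := by
    have h1 := hA1 (δm / 4) le_rfl (by linarith)
    have h2 : δm / 4 + δm = 5 * δm / 4 := by ring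
    rw [h2] at h1
    have h3 := Real.add_one_le_exp (-(δm / 4))
    have h4 : 0 < cm * μ * δm := by positivity
    nlinarith [mul_le_mul_of_nonneg_left h3 hμ.le]
  have key : ∀ t, t₀ < t → t ≤ t₀ + 1 → Pm - δm / 2 < P t →
      x₅ < -μ * (1 - Real.exp (Pp - P t)) + ν * S (P t - P (t - 1)) := by
    intro t ht1 ht2 hP
    have hi := abs_lt.1 (hinit (t - 1) ⟨by linarith, by linarith⟩)
    rcases le_or_gt x₅ (P t - P (t - 1)) with hy | hy
    · have h1 : ν * S x₅ ≤ ν * S (P t - P (t - 1)) :=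
        mul_le_mul_of_nonneg_left (hSmono.monotone hy) hν.le
      have h2 : 0 < μ * Real.exp (Pp - P t) := by positivity
      linarith
    · have h1 : S (-(5 * δm / 4)) < S (P t - P (t - 1)) := hSmono (by linarith [hi.2])
      rw [hSodd] at h1
      have h2 := mul_lt_mul_of_pos_left h1 hν
      have h3 := Real.add_one_le_exp (Pp - P t)
      have h4 : x₅ / μ + δm / 2 + 1 < Real.exp (Pp - P t) := by linarith [hi.2]
      have h5 := mul_lt_mul_of_pos_left h4 hμ
      have h6 : μ * (x₅ / μ) = x₅ := by field_simp
      have h7 : 0 < μ * δm := by positivity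
      linarith
  have low : ∀ t, t₀ < t → t ≤ t₀ + 1 → Pm - δm / 2 < P t := by
    intro t ht1 ht2
    by_contra! hcon
    have h0 := (abs_lt.1 (hinit t₀ ⟨by linarith, le_rfl⟩)).1
    obtain ⟨m, hm1, hm2⟩ := exists_between (show Pm - δm / 2 < P t₀ by linarith)
    have hc : IsCompact (Set.Icc t₀ t ∩ {s | P s ≤ m}) :=
      isCompact_Icc.inter_right (isClosed_le hPcont continuous_const)
    obtain ⟨s, ⟨⟨hs1, hs2⟩, hs3⟩, hsl⟩ := hc.exists_isLeast
      ⟨t, ⟨ht1.le, le_rfl⟩, (hcon.trans hm1.le : P t ≤ m)⟩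
    have hs3' : P s ≤ m := hs3
    have hlt : t₀ < s := by
      rcases hs1.lt_or_eq with h | h
      · exact h
      · rw [← h] at hs3'
        linarith
    obtain ⟨c, ⟨hc1, hc2⟩, hc3⟩ := exists_hasDerivAt_eq_slope P _ hlt hPcont.continuousOn
      (fun x hx => hPafter x hx.1)
    have hPc : m < P c := by
      by_contra! h
      have := hsl ⟨⟨hc1.le, by linarith⟩, h⟩
      linarith
    have hk := key c hc1 (by linarith) (by linarith)
    rw [hc3] at hk
    have : (P s - P t₀) / (s - t₀) < 0 := div_neg_of_neg_of_pos (by linarith) (by linarith)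
    linarith
  intro t ht
  rw [(hPafter t ht.1).deriv]
  exact key t ht.1 ht.2 (low t ht.1 ht.2)
end

section
/- A large jump in fundamentals ignites a deterministic bubble: Suppose Assumption I' holds with constants δ_m > 0, c_m > 0, that ν S(x₅) = μ + x₅ with x₅ > 0, that |P(t) - P₋| < δ_m/2 for all t ∈ [t₀ - 1, t₀], and that the fundamental value jumps at t₀ from P₋ to P₊ with P₊ - P₋ ≥ x₅ + x₅/μ + δ_m. Then P(t) - P(t-1) > x₅ for all t ∈ [t₀ + 1, t₀ + 2]. -/
/-- Continuous first-exit principle. -/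
lemma first_exit (f : ℝ → ℝ) (hf : Continuous f) (a b : ℝ) (ha : 0 < f a)
    (h : ∀ t, a < t → t ≤ b → (∀ s, a ≤ s → s < t → 0 < f s) → 0 < f t) :
    ∀ t, a ≤ t → t ≤ b → 0 < f t := by
  intro t hat htb
  by_contra hc
  have hcomp : IsCompact (Set.Icc a b ∩ {t | f t ≤ 0}) :=
    isCompact_Icc.inter_right (isClosed_le hf continuous_const)
  obtain ⟨m, ⟨⟨ham, hmb⟩, hm⟩, hl⟩ := hcomp.exists_isLeast ⟨t, ⟨hat, htb⟩, not_lt.mp hc⟩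
  have hm' : f m ≤ 0 := hm
  have hne : a < m := by
    rcases ham.lt_or_eq with h1 | h1
    · exact h1
    · rw [← h1] at hm'; linarith
  have := h m hne hmb (fun s has hsm => by
    by_contra hs
    have := hl ⟨⟨has, hsm.le.trans hmb⟩, not_lt.mp hs⟩
    linarith)
  linarith

/-- **A large jump in fundamentals ignites a deterministic bubble.**
Suppose Assumption I' holds, `ν S x₅ = μ + x₅` with `x₅ > 0`, `|P t - P₋| < δm/2`
for all `t ∈ [t₀ - 1, t₀]`, and the fundamental value jumps at `t₀` from `P₋` to `P₊`
with `P₊ - P₋ ≥ x₅ + x₅/μ + δm`. Then `P t - P (t-1) > x₅` for all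
`t ∈ [t₀ + 1, t₀ + 2]`. -/
theorem deterministic_large_jump_bubble_ignition
    (μ ν Pm Pp t₀ δm cm x₅ : ℝ) (S P : ℝ → ℝ)
    (hμ : 0 < μ) (hν : 0 < ν)
    (hSodd : ∀ x, S (-x) = -S x) (hSmono : StrictMono S)
    (hPcont : Continuous P)
    (hPbefore : ∀ t : ℝ, t < t₀ →
      HasDerivAt P (-μ * (1 - Real.exp (Pm - P t)) + ν * S (P t - P (t - 1))) t)
    (hPafter : ∀ t : ℝ, t₀ < t →
      HasDerivAt P (-μ * (1 - Real.exp (Pp - P t)) + ν * S (P t - P (t - 1))) t)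
    (hδm : 0 < δm) (hcm : 0 < cm)
    (hA1 : ∀ x, δm / 4 ≤ x → x ≤ δm →
      -μ * (1 - Real.exp (-x)) + ν * S (x + δm) < -(cm * μ * δm))
    (hA2 : ∀ x, -δm ≤ x → x ≤ -(δm / 4) →
      cm * μ * δm < -μ * (1 - Real.exp (-x)) + ν * S (x - δm))
    (hx₅ : 0 < x₅) (hroot : ν * S x₅ = μ + x₅)
    (hinit : ∀ t ∈ Set.Icc (t₀ - 1) t₀, |P t - Pm| < δm / 2)
    (hjump : x₅ + x₅ / μ + δm ≤ Pp - Pm) :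
    ∀ t ∈ Set.Icc (t₀ + 1) (t₀ + 2), x₅ < P t - P (t - 1) := by
  set F : ℝ → ℝ := fun t => -μ * (1 - Real.exp (Pp - P t)) + ν * S (P t - P (t - 1)) with hF
  have slope : ∀ a b, t₀ ≤ a → a < b → (∀ s, a < s → s < b → x₅ < F s) →
      x₅ * (b - a) < P b - P a := by
    intro a b ha hab h
    obtain ⟨c, hc, he⟩ := exists_hasDerivAt_eq_slope P F hab hPcont.continuousOn
      (fun s hs => hPafter s (lt_of_le_of_lt ha hs.1))
    have h1 := h c hc.1 hc.2
    rw [he, lt_div_iff₀ (by linarith)] at h1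
    exact h1
  -- derivative bound in the bubble regime
  have big : ∀ t, x₅ < P t - P (t - 1) → x₅ < F t := by
    intro t ht
    have h1 := mul_lt_mul_of_pos_left (hSmono ht) hν
    have h2 := mul_pos hμ (Real.exp_pos (Pp - P t))
    simp only [hF]
    linarith
  -- derivative bound on the first unit interval
  have early : ∀ t, t₀ < t → t ≤ t₀ + 1 → Pm - 3 * δm / 4 < P t → x₅ < F t := by
    intro t h0 h1 hP
    have hi := abs_lt.mp (hinit (t - 1) ⟨by linarith, by linarith⟩)
    by_cases hc : x₅ < P t - P (t - 1)
    · exact big t hc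
    · have hA := hA2 (-(δm / 4)) (by linarith) le_rfl
      rw [neg_neg] at hA
      have hS := mul_lt_mul_of_pos_left
        (hSmono (show -(δm / 4) - δm < P t - P (t - 1) by linarith)) hν
      have hcp : 0 < cm * μ * δm := by positivity
      have hxm : 0 < x₅ / μ := by positivity
      have he : Real.exp (δm / 4) * (1 + (x₅ / μ + δm / 4)) ≤ Real.exp (Pp - P t) := by
        calc Real.exp (δm / 4) * (1 + (x₅ / μ + δm / 4))
            ≤ Real.exp (δm / 4) * Real.exp (x₅ / μ + δm / 4) := by
              apply mul_le_mul_of_nonneg_left _ (Real.exp_pos _).le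
              linarith [Real.add_one_le_exp (x₅ / μ + δm / 4)]
          _ = Real.exp (δm / 4 + (x₅ / μ + δm / 4)) := (Real.exp_add _ _).symm
          _ ≤ _ := Real.exp_le_exp.mpr (by linarith)
      have h1e : 1 ≤ Real.exp (δm / 4) := Real.one_le_exp (by linarith)
      have h3 : x₅ / μ ≤ Real.exp (Pp - P t) - Real.exp (δm / 4) := by
        nlinarith
      have h4 := mul_le_mul_of_nonneg_left h3 hμ.le
      rw [mul_div_cancel₀ _ hμ.ne'] at h4
      simp only [hF]
      linarith
  have hi0 := abs_lt.mp (hinit t₀ ⟨by linarith, le_rfl⟩)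
  have phase1 : ∀ t, t₀ ≤ t → t ≤ t₀ + 1 → 0 < P t - (Pm - 3 * δm / 4) := by
    apply first_exit (fun t => P t - (Pm - 3 * δm / 4)) (by fun_prop)
    · linarith
    · intro t h0 h1 h
      have := slope t₀ t le_rfl h0
        (fun s hs hst => early s hs (by linarith) (by have := h s hs.le hst; linarith))
      have h5 : 0 < x₅ * (t - t₀) := mul_pos hx₅ (by linarith)
      linarith
  have der1 : ∀ s, t₀ < s → s ≤ t₀ + 1 → x₅ < F s := fun s h0 h1 =>
    early s h0 h1 (by have := phase1 s h0.le h1; linarith)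
  have phase2 : ∀ t, t₀ + 1 ≤ t → t ≤ t₀ + 2 → 0 < P t - P (t - 1) - x₅ := by
    apply first_exit (fun t => P t - P (t - 1) - x₅) (by fun_prop)
    · have := slope t₀ (t₀ + 1) le_rfl (by linarith) (fun s h0 h1 => der1 s h0 h1.le)
      simp only [add_sub_cancel_right]; linarith
    · intro t h0 h1 h
      have := slope (t - 1) t (by linarith) (by linarith) (fun s hs hst => by
        rcases le_total s (t₀ + 1) with h2 | h2
        · exact der1 s (by linarith) h2
        · exact big s (by have := h s h2 hst; linarith))
      linarith
  intro t ht
  linarith [phase2 t ht.1 ht.2]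
end

section
/- Pathwise stability of the mean reversion regime under small noise: Suppose Assumption I' holds with constants δ_m > 0, c_m > 0, that |P(t) - P₀| < δ_m for all t ∈ [t₀ - 1, t₀] and |P(t₀) - P₀| < δ_m/2, and that the noise path satisfies |W(t₂) - W(t₁)| < min(c_m μ, 1/4)·δ_m for all t₁ < t₂ with t₁, t₂ ∈ [t₀, t₀ + 1]. Then |P(t) - P₀| ≤ δ_m for all t ∈ [t₀, t₀ + 1], and |P(t₀ + 1) - P₀| < δ_m/2. -/
/-- A last time at which a continuous function is at most `a`. -/
lemma last_time (x : ℝ → ℝ) (hx : Continuous x) (a r T : ℝ) (hrT : r ≤ T)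
    (h0 : x r ≤ a) : ∃ s, r ≤ s ∧ s ≤ T ∧ x s ≤ a ∧ ∀ u, s < u → u ≤ T → a < x u := by
  have hK : IsCompact (Set.Icc r T ∩ {u | x u ≤ a}) :=
    isCompact_Icc.inter_right (isClosed_le hx continuous_const)
  obtain ⟨s, hs, hmax⟩ := hK.exists_isGreatest ⟨r, ⟨le_refl r, hrT⟩, h0⟩
  refine ⟨s, hs.1.1, hs.1.2, hs.2, fun u hu huT => ?_⟩
  by_contra hcon
  have := hmax ⟨⟨hs.1.1.trans hu.le, huT⟩, not_lt.mp hcon⟩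
  linarith

/-- One-sided version of the stability statement. -/
lemma one_sided (x f W : ℝ → ℝ) (t₀ δ c : ℝ) (hδ : 0 < δ) (hc : 0 < c) (hx : Continuous x)
    (hf : ∀ s t, IntervalIntegrable f MeasureTheory.volume s t)
    (hEq : ∀ s t : ℝ, s ≤ t → x t - x s = (∫ u in s..t, f u) + (W t - W s))
    (hdrift : ∀ u, t₀ ≤ u → u ≤ t₀ + 1 → δ / 4 ≤ x u → x u ≤ δ → f u ≤ -(c * δ))
    (h0 : x t₀ < δ / 2)
    (hW : ∀ t₁ t₂ : ℝ, t₀ ≤ t₁ → t₁ < t₂ → t₂ ≤ t₀ + 1 →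
      W t₂ - W t₁ < min c (1 / 4) * δ) :
    (∀ t ∈ Set.Icc t₀ (t₀ + 1), x t < δ) ∧ x (t₀ + 1) < δ / 2 := by
  have hW1 : ∀ t₁ t₂ : ℝ, t₀ ≤ t₁ → t₁ < t₂ → t₂ ≤ t₀ + 1 → W t₂ - W t₁ < c * δ :=
    fun a b h1 h2 h3 => (hW a b h1 h2 h3).trans_le
      (mul_le_mul_of_nonneg_right (min_le_left _ _) hδ.le)
  have hW2 : ∀ t₁ t₂ : ℝ, t₀ ≤ t₁ → t₁ < t₂ → t₂ ≤ t₀ + 1 → W t₂ - W t₁ < 1 / 4 * δ :=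
    fun a b h1 h2 h3 => (hW a b h1 h2 h3).trans_le
      (mul_le_mul_of_nonneg_right (min_le_right _ _) hδ.le)
  have core : ∀ s t, t₀ ≤ s → s < t → t ≤ t₀ + 1 →
      (∀ u, s < u → u < t → δ / 4 ≤ x u ∧ x u ≤ δ) →
      x t - x s ≤ (t - s) * (-(c * δ)) + (W t - W s) := by
    intro s t hs hst ht hb
    have h1 : (∫ u in s..t, f u) ≤ ∫ u in s..t, (-(c * δ)) := by
      apply intervalIntegral.integral_mono_on_of_le_Ioo hst.le (hf s t) intervalIntegrable_const
      intro u hu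
      have := hb u hu.1 hu.2
      exact hdrift u (hs.trans hu.1.le) (hu.2.le.trans ht) this.1 this.2
    rw [intervalIntegral.integral_const, smul_eq_mul] at h1
    rw [hEq s t hst.le]
    linarith
  have hcδ : 0 < c * δ := mul_pos hc hδ
  have hA : ∀ t ∈ Set.Icc t₀ (t₀ + 1), x t < δ := by
    intro t ht
    by_contra hcon
    have hK : IsCompact (Set.Icc t₀ (t₀ + 1) ∩ {u | δ ≤ x u}) :=
      isCompact_Icc.inter_right (isClosed_le continuous_const hx)
    obtain ⟨T, hT, hmin⟩ := hK.exists_isLeast ⟨t, ht, not_lt.mp hcon⟩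
    have hTδ : δ ≤ x T := hT.2
    obtain ⟨s, hs1, hs2, hs3, hs4⟩ := last_time x hx (δ / 2) t₀ T hT.1.1 h0.le
    have hsT : s < T := lt_of_le_of_ne hs2 (by rintro rfl; linarith)
    have h := core s T hs1 hsT hT.1.2 (fun u hu1 hu2 => by
      refine ⟨by linarith [hs4 u hu1 hu2.le], ?_⟩
      by_contra hc2
      have := hmin ⟨⟨hs1.trans hu1.le, hu2.le.trans hT.1.2⟩, (not_le.mp hc2).le⟩
      linarith)
    have hw := hW2 s T hs1 hsT hT.1.2
    have : 0 < (T - s) * (c * δ) := mul_pos (sub_pos.mpr hsT) hcδ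
    linarith
  refine ⟨hA, ?_⟩
  by_contra hcon
  push Not at hcon
  by_cases hall : ∀ u, t₀ < u → u < t₀ + 1 → δ / 4 ≤ x u
  · have h := core t₀ (t₀ + 1) le_rfl (by linarith) le_rfl
      (fun u h1 h2 => ⟨hall u h1 h2, (hA u ⟨h1.le, h2.le⟩).le⟩)
    have hw := hW1 t₀ (t₀ + 1) le_rfl (by linarith) le_rfl
    have : (t₀ + 1 - t₀) * (-(c * δ)) = -(c * δ) := by ring
    linarith
  · push Not at hall
    obtain ⟨r, hr1, hr2, hr3⟩ := hall
    obtain ⟨s, hs1, hs2, hs3, hs4⟩ := last_time x hx (δ / 4) r (t₀ + 1) hr2.le hr3.le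
    have hs0 : t₀ ≤ s := hr1.le.trans hs1
    have hsT : s < t₀ + 1 := lt_of_le_of_ne hs2 (by rintro rfl; linarith)
    have h := core s (t₀ + 1) hs0 hsT le_rfl
      (fun u h1 h2 => ⟨(hs4 u h1 h2.le).le, (hA u ⟨hs0.trans h1.le, h2.le⟩).le⟩)
    have hw := hW2 s (t₀ + 1) hs0 hsT le_rfl
    have : 0 < (t₀ + 1 - s) * (c * δ) := mul_pos (sub_pos.mpr hsT) hcδ
    linarith

/-- A monotone function of a continuous function is interval integrable. -/
lemma mono_comp_integrable (S g : ℝ → ℝ) (hS : Monotone S) (hg : Continuous g) (s t : ℝ) :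
    IntervalIntegrable (fun u => S (g u)) MeasureTheory.volume s t := by
  obtain ⟨C, hC⟩ := (isCompact_uIcc (a := s) (b := t)).exists_bound_of_continuousOn hg.continuousOn
  have hmeas : Measurable (fun u => S (g u)) := hS.measurable.comp hg.measurable
  apply (intervalIntegrable_const (c := max |S C| |S (-C)|)).mono_fun hmeas.aestronglyMeasurable
  filter_upwards [MeasureTheory.ae_restrict_mem measurableSet_uIoc] with u hu
  have h := abs_le.mp (hC u (Set.uIoc_subset_uIcc hu))
  rw [Real.norm_eq_abs, Real.norm_eq_abs]
  refine le_trans ?_ (le_abs_self _)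
  rw [max_comm]
  exact abs_le_max_abs_abs (hS h.1) (hS h.2)

/-- **Pathwise stability of the mean reversion regime under small noise.**
Suppose Assumption I' holds, `|P t - P₀| < δm` on `[t₀ - 1, t₀]` with
`|P t₀ - P₀| < δm/2`, and the noise path satisfies
`|W t₂ - W t₁| < min (cm μ) (1/4) · δm` for all `t₁ < t₂` in `[t₀, t₀ + 1]`.
Then `|P t - P₀| ≤ δm` for all `t ∈ [t₀, t₀ + 1]`, and `|P (t₀+1) - P₀| < δm/2`. -/
theorem pathwise_mean_reversion_stability
    (μ ν P₀ t₀ δm cm : ℝ) (S P W : ℝ → ℝ)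
    (hμ : 0 < μ) (hν : 0 < ν)
    (hSodd : ∀ x, S (-x) = -S x) (hSmono : StrictMono S)
    (hPcont : Continuous P) (hWcont : Continuous W)
    (hEq : ∀ s t : ℝ, s ≤ t → P t - P s =
      (∫ u in s..t, (-μ * (1 - Real.exp (P₀ - P u)) + ν * S (P u - P (u - 1)))) +
        (W t - W s))
    (hδm : 0 < δm) (hcm : 0 < cm)
    (hA1 : ∀ x, δm / 4 ≤ x → x ≤ δm →
      -μ * (1 - Real.exp (-x)) + ν * S (x + δm) < -(cm * μ * δm))
    (hA2 : ∀ x, -δm ≤ x → x ≤ -(δm / 4) →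
      cm * μ * δm < -μ * (1 - Real.exp (-x)) + ν * S (x - δm))
    (hinit : ∀ t ∈ Set.Icc (t₀ - 1) t₀, |P t - P₀| < δm)
    (hinit₀ : |P t₀ - P₀| < δm / 2)
    (hW : ∀ t₁ t₂ : ℝ, t₀ ≤ t₁ → t₁ < t₂ → t₂ ≤ t₀ + 1 →
      |W t₂ - W t₁| < min (cm * μ) (1 / 4) * δm) :
    (∀ t ∈ Set.Icc t₀ (t₀ + 1), |P t - P₀| ≤ δm) ∧ |P (t₀ + 1) - P₀| < δm / 2 := by
  have hint : ∀ s t, IntervalIntegrable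
      (fun u => -μ * (1 - Real.exp (P₀ - P u)) + ν * S (P u - P (u - 1)))
      MeasureTheory.volume s t := by
    intro s t
    apply IntervalIntegrable.add
    · exact Continuous.intervalIntegrable (by fun_prop) _ _
    · exact (mono_comp_integrable S (fun u => P u - P (u - 1)) hSmono.monotone
        (by fun_prop) s t).const_mul ν
  have h0 := abs_lt.mp hinit₀
  have hup := one_sided (fun t => P t - P₀) _ W t₀ δm (cm * μ) hδm (mul_pos hcm hμ)
    (by fun_prop) hint (fun s t hst => by rw [← hEq s t hst]; ring)
    (fun u h1 h2 h3 h4 => by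
      have hd := abs_lt.mp (hinit (u - 1) ⟨by linarith, by linarith⟩)
      have ha := hA1 _ h3 h4
      have hs : S (P u - P (u - 1)) ≤ S (P u - P₀ + δm) := hSmono.monotone (by linarith)
      have := mul_le_mul_of_nonneg_left hs hν.le
      rw [neg_sub] at ha
      linarith)
    h0.2 (fun a b h1 h2 h3 => (le_abs_self _).trans_lt (hW a b h1 h2 h3))
  have hdn := one_sided (fun t => -(P t - P₀))
    (fun u => -(-μ * (1 - Real.exp (P₀ - P u)) + ν * S (P u - P (u - 1))))
    (fun t => -W t) t₀ δm (cm * μ) hδm (mul_pos hcm hμ)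
    (by fun_prop) (fun s t => (hint s t).neg)
    (fun s t hst => by
      have := hEq s t hst
      rw [intervalIntegral.integral_neg]
      linarith)
    (fun u h1 h2 h3 h4 => by
      have hd := abs_lt.mp (hinit (u - 1) ⟨by linarith, by linarith⟩)
      have ha := hA2 (P u - P₀) (by linarith) (by linarith)
      have hs : S (P u - P₀ - δm) ≤ S (P u - P (u - 1)) := hSmono.monotone (by linarith)
      have := mul_le_mul_of_nonneg_left hs hν.le
      rw [neg_sub] at ha
      linarith)
    (by linarith [h0.1])
    (fun a b h1 h2 h3 => by
      have := (abs_lt.mp (hW a b h1 h2 h3)).1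
      linarith)
  refine ⟨fun t ht => abs_le.mpr ⟨?_, (hup.1 t ht).le⟩, abs_lt.mpr ⟨?_, hup.2⟩⟩
  · have := hdn.1 t ht
    linarith
  · have := hdn.2
    linarith
end

section
/- Pathwise stability of the bubble regime under small noise: Suppose a_b ∈ ℝ and ε_b > 0 satisfy ν S(a_b) = μ + a_b + ε_b, that P(t) - P(t-1) > a_b for all t ∈ [t₀ - 1, t₀], and that the noise path satisfies W(t₂) - W(t₁) > -ε_b/2 for all t₁ < t₂ with t₁, t₂ ∈ [t₀ - 1, t₀ + 1]. Then P(t) - P(t-1) > a_b for all t ∈ [t₀, t₀ + 1]. -/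
/-- **Pathwise stability of the bubble regime under small noise.**
Suppose `ν S a_b = μ + a_b + ε_b` with `ε_b > 0`, `P t - P (t-1) > a_b` for all
`t ∈ [t₀ - 1, t₀]`, and the noise path satisfies `W t₂ - W t₁ > -ε_b/2` for all
`t₁ < t₂` in `[t₀ - 1, t₀ + 1]`. Then `P t - P (t-1) > a_b` for all
`t ∈ [t₀, t₀ + 1]`. -/
theorem pathwise_bubble_stability
    (μ ν P₀ t₀ ab εb : ℝ) (S P W : ℝ → ℝ)
    (hμ : 0 < μ) (hν : 0 < ν)
    (hSodd : ∀ x, S (-x) = -S x) (hSmono : StrictMono S)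
    (hPcont : Continuous P) (hWcont : Continuous W)
    (hEq : ∀ s t : ℝ, s ≤ t → P t - P s =
      (∫ u in s..t, (-μ * (1 - Real.exp (P₀ - P u)) + ν * S (P u - P (u - 1)))) +
        (W t - W s))
    (hεb : 0 < εb) (hab : ν * S ab = μ + ab + εb)
    (hinit : ∀ t ∈ Set.Icc (t₀ - 1) t₀, ab < P t - P (t - 1))
    (hW : ∀ t₁ t₂ : ℝ, t₀ - 1 ≤ t₁ → t₁ < t₂ → t₂ ≤ t₀ + 1 →
      -(εb / 2) < W t₂ - W t₁) :
    ∀ t ∈ Set.Icc t₀ (t₀ + 1), ab < P t - P (t - 1) := by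
  by_contra hcon
  push Not at hcon
  obtain ⟨t', ht', hle'⟩ := hcon
  have hDc : Continuous (fun t : ℝ => P t - P (t - 1)) := by fun_prop
  have hK : IsCompact (Set.Icc t₀ (t₀ + 1) ∩ {t : ℝ | P t - P (t - 1) ≤ ab}) :=
    isCompact_Icc.inter_right (isClosed_le hDc continuous_const)
  obtain ⟨τ, ⟨hτI, hτle⟩, hτmin⟩ := hK.exists_isLeast ⟨t', ht', hle'⟩
  have hτle2 : P τ - P (τ - 1) ≤ ab := hτle
  have hbefore : ∀ u ∈ Set.Icc (τ - 1) τ, u ≠ τ → ab < P u - P (u - 1) := by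
    intro u hu hne
    by_cases h : u ≤ t₀
    · exact hinit u ⟨by linarith [hu.1, hτI.1], h⟩
    · by_contra hc
      have h1 : τ ≤ u := hτmin ⟨⟨by linarith, by linarith [hu.2, hτI.2]⟩, not_lt.mp hc⟩
      exact hne (le_antisymm hu.2 h1)
  -- integrability of the drift on the window
  have hI1 : IntervalIntegrable (fun u => -μ * (1 - Real.exp (P₀ - P u)))
      MeasureTheory.volume (τ - 1) τ := by
    apply Continuous.intervalIntegrable
    fun_prop
  have hI2 : IntervalIntegrable (fun u => ν * S (P u - P (u - 1)))
      MeasureTheory.volume (τ - 1) τ := by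
    apply IntervalIntegrable.const_mul
    obtain ⟨C, hC⟩ := (isCompact_Icc (a := τ - 1) (b := τ)).exists_bound_of_continuousOn
      hDc.continuousOn
    rw [intervalIntegrable_iff_integrableOn_Icc_of_le (by linarith)]
    apply MeasureTheory.Measure.integrableOn_of_bounded (M := S C)
    · simp
    · exact (hSmono.monotone.measurable.comp hDc.measurable).aestronglyMeasurable
    · refine (MeasureTheory.ae_restrict_iff' measurableSet_Icc).2 (Filter.Eventually.of_forall ?_)
      intro u hu
      have h := hC u hu
      rw [Real.norm_eq_abs, abs_le] at h ⊢
      exact ⟨by rw [← hSodd]; exact hSmono.monotone h.1, hSmono.monotone h.2⟩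
  have hint : (∫ _ in (τ - 1)..τ, (ab + εb)) ≤
      ∫ u in (τ - 1)..τ, (-μ * (1 - Real.exp (P₀ - P u)) + ν * S (P u - P (u - 1))) := by
    apply intervalIntegral.integral_mono_on_of_le_Ioo (by linarith) (by simp) (hI1.add hI2)
    intro u hu
    have h1 := hSmono (hbefore u ⟨hu.1.le, hu.2.le⟩ hu.2.ne)
    have h2 := mul_lt_mul_of_pos_left h1 hν
    have h3 := mul_pos hμ (Real.exp_pos (P₀ - P u))
    linarith
  rw [intervalIntegral.integral_const] at hint
  have h4 := hEq (τ - 1) τ (by linarith)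
  have h5 := hW (τ - 1) τ (by linarith [hτI.1]) (by linarith) hτI.2
  simp only [sub_sub_cancel, one_smul] at hint
  linarith
end

section
/- Pathwise stability of the collapse regime under small noise: Suppose a_c ∈ ℝ and ε_c > 0 satisfy ν S(a_c) = a_c - ε_c, that P(t) - P(t-1) < a_c and P(t) > P₀ for all t ∈ [t₀ - 1, t₀], and that the noise path satisfies W(t₂) - W(t₁) < ε_c/2 for all t₁ < t₂ with t₁, t₂ ∈ [t₀ - 1, t₀ + 1]. Then either there exists t ∈ [t₀, t₀ + 1] with P(t) ≤ P₀, or P(t) - P(t-1) < a_c for all t ∈ [t₀, t₀ + 1]. -/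
/-- **Pathwise stability of the collapse regime under small noise.**
Suppose `ν S a_c = a_c - ε_c` with `ε_c > 0`, `P t - P (t-1) < a_c` and `P t > P₀`
for all `t ∈ [t₀ - 1, t₀]`, and the noise path satisfies `W t₂ - W t₁ < ε_c/2` for
all `t₁ < t₂` in `[t₀ - 1, t₀ + 1]`. Then either there exists `t ∈ [t₀, t₀ + 1]`
with `P t ≤ P₀`, or `P t - P (t-1) < a_c` for all `t ∈ [t₀, t₀ + 1]`. -/
theorem pathwise_collapse_stability
    (μ ν P₀ t₀ ac εc : ℝ) (S P W : ℝ → ℝ)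
    (hμ : 0 < μ) (hν : 0 < ν)
    (hSodd : ∀ x, S (-x) = -S x) (hSmono : StrictMono S)
    (hPcont : Continuous P) (hWcont : Continuous W)
    (hEq : ∀ s t : ℝ, s ≤ t → P t - P s =
      (∫ u in s..t, (-μ * (1 - Real.exp (P₀ - P u)) + ν * S (P u - P (u - 1)))) +
        (W t - W s))
    (hεc : 0 < εc) (hac : ν * S ac = ac - εc)
    (hinit : ∀ t ∈ Set.Icc (t₀ - 1) t₀, P t - P (t - 1) < ac ∧ P₀ < P t)
    (hW : ∀ t₁ t₂ : ℝ, t₀ - 1 ≤ t₁ → t₁ < t₂ → t₂ ≤ t₀ + 1 →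
      W t₂ - W t₁ < εc / 2) :
    (∃ t ∈ Set.Icc t₀ (t₀ + 1), P t ≤ P₀) ∨
      (∀ t ∈ Set.Icc t₀ (t₀ + 1), P t - P (t - 1) < ac) := by
  by_cases hP : ∃ t ∈ Set.Icc t₀ (t₀ + 1), P t ≤ P₀
  · exact Or.inl hP
  right
  push Not at hP
  by_contra hcon
  push Not at hcon
  obtain ⟨t', ht', hat'⟩ := hcon
  have hg : Continuous (fun u => P u - P (u - 1)) := by fun_prop
  have hcomp : IsCompact (Set.Icc t₀ (t₀ + 1) ∩ {t | ac ≤ P t - P (t - 1)}) :=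
    isCompact_Icc.inter_right (isClosed_le continuous_const hg)
  obtain ⟨τ, ⟨hτ, haτ⟩, hleast⟩ := hcomp.exists_isLeast ⟨t', ht', hat'⟩
  simp only [Set.mem_setOf_eq] at haτ
  have hlt : ∀ u, t₀ - 1 ≤ u → u < τ → P u - P (u - 1) < ac := by
    intro u hu huτ
    rcases le_total u t₀ with h | h
    · exact (hinit u ⟨hu, h⟩).1
    · by_contra hc
      push Not at hc
      have := hleast ⟨⟨h, by linarith [hτ.2]⟩, hc⟩
      linarith
  have hpos : ∀ u, t₀ - 1 ≤ u → u < τ → P₀ < P u := by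
    intro u hu huτ
    rcases le_total u t₀ with h | h
    · exact (hinit u ⟨hu, h⟩).2
    · exact hP u ⟨h, by linarith [hτ.2]⟩
  have hSint : IntervalIntegrable (fun u => S (P u - P (u - 1))) MeasureTheory.volume (τ - 1) τ := by
    rw [intervalIntegrable_iff]
    obtain ⟨C, hC⟩ := (isCompact_Icc (a := τ - 1) (b := τ)).exists_bound_of_continuousOn hg.continuousOn
    have hm : Measurable (fun u => S (P u - P (u - 1))) :=
      hSmono.monotone.measurable.comp hg.measurable
    refine MeasureTheory.Measure.integrableOn_of_bounded (M := S C) ?_ hm.aestronglyMeasurable ?_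
    · simp [Set.uIoc]
    · refine (MeasureTheory.ae_restrict_mem measurableSet_uIoc).mono ?_
      intro u hu
      rw [Set.uIoc_of_le (by linarith)] at hu
      have h := abs_le.mp (hC u ⟨hu.1.le, hu.2⟩)
      rw [Real.norm_eq_abs, abs_le, ← hSodd]
      exact ⟨hSmono.monotone h.1, hSmono.monotone h.2⟩
  have hEint : IntervalIntegrable (fun u => -μ * (1 - Real.exp (P₀ - P u)))
      MeasureTheory.volume (τ - 1) τ :=
    Continuous.intervalIntegrable (by fun_prop) _ _
  have hint := hEint.add (hSint.const_mul ν)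
  have hle : (∫ u in (τ - 1)..τ, (-μ * (1 - Real.exp (P₀ - P u)) + ν * S (P u - P (u - 1))))
      ≤ ∫ _u in (τ - 1)..τ, (ac - εc) := by
    refine intervalIntegral.integral_mono_on_of_le_Ioo (by linarith) hint
      intervalIntegrable_const ?_
    intro u hu
    have h0 : t₀ - 1 ≤ u := by linarith [hu.1, hτ.1]
    have h1 : S (P u - P (u - 1)) ≤ S ac := hSmono.monotone (hlt u h0 hu.2).le
    have h2 : Real.exp (P₀ - P u) ≤ 1 := Real.exp_le_one_iff.mpr (by linarith [hpos u h0 hu.2])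
    have h3 := mul_le_mul_of_nonneg_left h1 hν.le
    have h4 : 0 ≤ μ * (1 - Real.exp (P₀ - P u)) := mul_nonneg hμ.le (by linarith)
    linarith
  rw [intervalIntegral.integral_const] at hle
  have h5 := hEq (τ - 1) τ (by linarith)
  have h6 := hW (τ - 1) τ (by linarith [hτ.1]) (by linarith) hτ.2
  simp only [smul_eq_mul] at hle
  linarith
end

section
/- Pathwise bubble ignition from the mean reversion regime: Suppose Assumption I' holds with constants δ_m > 0, c_m > 0, that a_b > δ_m and ε_b > 0 satisfy ν S(a_b) = μ + a_b + ε_b, and that |P(t) - P₀| < δ_m for all t ∈ [t₀ - 1, t₀] with |P(t₀) - P₀| < δ_m/2. Suppose the noise path satisfies: (i) |W(t) - W(t₀) - (a_b + 2μ + δ_m + ε_b)(t - t₀)| ≤ min(δ_m, ε_b)/4 for all t ∈ [t₀, t₀ + 1], and (ii) W(t₃) - W(t₂) > -ε_b/4 for all t₂ < t₃ with t₂, t₃ ∈ [t₀ + 1, t₀ + 2]. Then P(t) - P(t-1) > a_b for all t ∈ [t₀ + 1, t₀ + 2]. -/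
/-- Continuous induction: a first-exit argument. -/
theorem first_exit_aux (g : ℝ → ℝ) (hg : Continuous g) (a b : ℝ)
    (h : ∀ t ∈ Set.Icc a b, (∀ u, a ≤ u → u < t → 0 < g u) → 0 < g t) :
    ∀ t ∈ Set.Icc a b, 0 < g t := by
  by_contra! hcon
  obtain ⟨t, ht, hgt⟩ := hcon
  have hc : IsCompact (Set.Icc a b ∩ {t | g t ≤ 0}) :=
    isCompact_Icc.inter_right (isClosed_le hg continuous_const)
  obtain ⟨m, hm, hmin⟩ := hc.exists_isLeast ⟨t, ht, hgt⟩
  have h1 := h m hm.1 (by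
    intro u hu hum
    by_contra! hle
    have := hmin ⟨⟨hu, hum.le.trans hm.1.2⟩, hle⟩
    linarith)
  have h2 : g m ≤ 0 := hm.2
  linarith

/-- **Pathwise bubble ignition from the mean reversion regime.**
Suppose Assumption I' holds, `ν S a_b = μ + a_b + ε_b` with `a_b > δm` and
`ε_b > 0`, and `|P t - P₀| < δm` on `[t₀-1, t₀]` with `|P t₀ - P₀| < δm/2`.
If the noise path satisfies
(i) `|W t - W t₀ - (a_b + 2μ + δm + ε_b)(t - t₀)| ≤ min δm ε_b / 4` on `[t₀, t₀+1]`,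
and (ii) `W t₃ - W t₂ > -ε_b/4` for all `t₂ < t₃` in `[t₀+1, t₀+2]`, then
`P t - P (t-1) > a_b` for all `t ∈ [t₀+1, t₀+2]`. -/
theorem pathwise_bubble_ignition
    (μ ν P₀ t₀ δm cm ab εb : ℝ) (S P W : ℝ → ℝ)
    (hμ : 0 < μ) (hν : 0 < ν)
    (hSodd : ∀ x, S (-x) = -S x) (hSmono : StrictMono S)
    (hPcont : Continuous P) (hWcont : Continuous W)
    (hEq : ∀ s t : ℝ, s ≤ t → P t - P s =
      (∫ u in s..t, (-μ * (1 - Real.exp (P₀ - P u)) + ν * S (P u - P (u - 1)))) +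
        (W t - W s))
    (hδm : 0 < δm) (hcm : 0 < cm)
    (hA1 : ∀ x, δm / 4 ≤ x → x ≤ δm →
      -μ * (1 - Real.exp (-x)) + ν * S (x + δm) < -(cm * μ * δm))
    (hA2 : ∀ x, -δm ≤ x → x ≤ -(δm / 4) →
      cm * μ * δm < -μ * (1 - Real.exp (-x)) + ν * S (x - δm))
    (hab : δm < ab) (hεb : 0 < εb) (habroot : ν * S ab = μ + ab + εb)
    (hinit : ∀ t ∈ Set.Icc (t₀ - 1) t₀, |P t - P₀| < δm)
    (hinit₀ : |P t₀ - P₀| < δm / 2)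
    (hW1 : ∀ t ∈ Set.Icc t₀ (t₀ + 1),
      |W t - W t₀ - (ab + 2 * μ + δm + εb) * (t - t₀)| ≤ min δm εb / 4)
    (hW2 : ∀ t₂ t₃ : ℝ, t₀ + 1 ≤ t₂ → t₂ < t₃ → t₃ ≤ t₀ + 2 →
      -(εb / 4) < W t₃ - W t₂) :
    ∀ t ∈ Set.Icc (t₀ + 1) (t₀ + 2), ab < P t - P (t - 1) := by
  set f : ℝ → ℝ := fun u => -μ * (1 - Real.exp (P₀ - P u)) + ν * S (P u - P (u - 1)) with hf
  have hint : ∀ s t, IntervalIntegrable f MeasureTheory.volume s t := by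
    intro s t
    have hd : Continuous fun u => P u - P (u - 1) := by fun_prop
    have h1 : Continuous fun u => -μ * (1 - Real.exp (P₀ - P u)) := by fun_prop
    refine (h1.intervalIntegrable s t).add (IntervalIntegrable.const_mul ?_ ν)
    obtain ⟨M, hM⟩ := (isCompact_uIcc (a := s) (b := t)).exists_bound_of_continuousOn
      hd.continuousOn
    refine (intervalIntegrable_const (c := S M)).mono_fun
      (hSmono.monotone.measurable.comp hd.measurable).aestronglyMeasurable ?_
    refine (MeasureTheory.ae_restrict_iff' measurableSet_uIoc).2 (Filter.Eventually.of_forall ?_)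
    intro u hu
    have h2 := hM u (Set.uIoc_subset_uIcc hu)
    rw [Real.norm_eq_abs, abs_le] at h2
    refine le_trans ?_ (le_abs_self _)
    show ‖S (P u - P (u - 1))‖ ≤ S M
    rw [Real.norm_eq_abs, abs_le, ← hSodd]
    exact ⟨hSmono.monotone h2.1, hSmono.monotone h2.2⟩
  have hlow : ∀ c s t, s ≤ t → (∀ u, s < u → u < t → c ≤ f u) →
      c * (t - s) + (W t - W s) ≤ P t - P s := by
    intro c s t hst h
    rw [hEq s t hst]
    have := intervalIntegral.integral_mono_on_of_le_Ioo hst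
      (intervalIntegrable_const (c := c)) (hint s t) (fun u hu => h u hu.1 hu.2)
    rw [intervalIntegral.integral_const, smul_eq_mul] at this
    linarith
  have hdrift : ∀ u y, y ≤ P u - P (u - 1) → -μ + ν * S y ≤ f u := by
    intro u y hy
    have h1 := mul_le_mul_of_nonneg_left (hSmono.monotone hy) hν.le
    have h2 := mul_pos hμ (Real.exp_pos (P₀ - P u))
    simp only [hf]
    linarith
  have hS2 : -μ ≤ ν * S (-(2 * δm)) := by
    have h1 := hA1 δm (by linarith) le_rfl
    have h2 := mul_pos hμ (Real.exp_pos (-δm))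
    have h3 := mul_pos (mul_pos hcm hμ) hδm
    rw [← two_mul] at h1
    rw [hSodd]
    linarith
  have hm1 := min_le_left δm εb
  have hm2 := min_le_right δm εb
  have hm0 : 0 < min δm εb := lt_min hδm hεb
  have hd1 : ∀ u, t₀ ≤ u → u ≤ t₀ + 1 → 0 < P u - P₀ + δm → -(2 * μ) ≤ f u := by
    intro u h1 h2 h3
    have h4 := abs_lt.1 (hinit (u - 1) ⟨by linarith, by linarith⟩)
    have := hdrift u (-(2 * δm)) (by linarith [h4.2])
    linarith
  have hx0 := abs_lt.1 hinit₀
  have hstep1 : ∀ t ∈ Set.Icc t₀ (t₀ + 1), 0 < P t - P₀ + δm := by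
    apply first_exit_aux (fun t => P t - P₀ + δm) (by fun_prop)
    intro t ht h
    have h1 := hlow (-(2 * μ)) t₀ t ht.1
      (fun u hu hut => hd1 u hu.le (hut.le.trans ht.2) (h u hu.le hut))
    have h2 := (abs_le.1 (hW1 t ht)).1
    have h3 : 0 ≤ (ab + δm + εb) * (t - t₀) :=
      mul_nonneg (by linarith) (by linarith [ht.1])
    show 0 < P t - P₀ + δm
    linarith [hx0.1]
  have hstep2 : ∀ t ∈ Set.Icc (t₀ + 1) (t₀ + 2), 0 < P t - P (t - 1) - ab := by
    apply first_exit_aux (fun t => P t - P (t - 1) - ab) (by fun_prop)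
    intro t ht h
    obtain ⟨ht1, ht2⟩ := ht
    have h1 := hlow (ab + εb) (t₀ + 1) t ht1 (fun u hu hut => by
      have := hdrift u ab (by linarith [h u hu.le hut])
      linarith)
    have h2 := hlow (-(2 * μ)) (t - 1) (t₀ + 1) (by linarith)
      (fun u hu hut => hd1 u (by linarith) hut.le (hstep1 u ⟨by linarith, hut.le⟩))
    have h3 := (abs_le.1 (hW1 (t - 1) ⟨by linarith, by linarith⟩)).2
    have h4 := (abs_le.1 (hW1 (t₀ + 1) ⟨by linarith, by linarith⟩)).1
    have h5 : -(εb / 4) ≤ W t - W (t₀ + 1) := by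
      rcases ht1.eq_or_lt with h | h
      · rw [← h]; linarith
      · exact (hW2 _ _ le_rfl h ht2).le
    have h6 : 0 ≤ δm * (t₀ + 2 - t) := mul_nonneg hδm.le (by linarith)
    show 0 < P t - P (t - 1) - ab
    linarith
  intro t ht
  linarith [hstep2 t ht]
end

section
/- Pathwise growth estimate after a large jump in fundamentals (key estimate (5.4)): Suppose Assumption I' holds with constants δ_m > 0, c_m > 0, that a_b > δ_m and ε_b > 0 satisfy ν S(a_b) = μ + a_b + ε_b, that |P(t) - P₋| < δ_m for all t ∈ [t₀ - 1, t₀] with |P(t₀) - P₋| < δ_m/2, that the fundamental value jumps at t₀ from P₋ to P₊ with P₊ - P₋ ≥ (2 a_b + 3 δ_m)/min(μ, 1), and that the noise path satisfies W(t₃) - W(t₂) > -min(δ_m, ε_b)/2 for all t₂ < t₃ with t₂, t₃ ∈ [t₀, t₀ + 1]. Then for all t₂ < t₃ with t₂, t₃ ∈ [t₀, t₀ + 1]: P(t₃) - P(t₂) > (a_b + min(δ_m, ε_b))(t₃ - t₂) - min(δ_m, ε_b)/2. -/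
/-- **Pathwise growth estimate after a large jump in fundamentals (key estimate
(5.4)).** Suppose Assumption I' holds, `ν S a_b = μ + a_b + ε_b` with `a_b > δm`,
`ε_b > 0`, `|P t - P₋| < δm` on `[t₀-1, t₀]` with `|P t₀ - P₋| < δm/2`, the
fundamental value jumps at `t₀` from `P₋` to `P₊` with
`P₊ - P₋ ≥ (2 a_b + 3 δm)/min μ 1`, and the noise path satisfies
`W t₃ - W t₂ > -min δm ε_b / 2` for all `t₂ < t₃` in `[t₀, t₀+1]`. Then for all
`t₂ < t₃` in `[t₀, t₀+1]`,
`P t₃ - P t₂ > (a_b + min δm ε_b)(t₃ - t₂) - min δm ε_b / 2`. -/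
theorem pathwise_large_jump_growth_estimate
    (μ ν Pm Pp t₀ δm cm ab εb : ℝ) (S P W : ℝ → ℝ)
    (hμ : 0 < μ) (hν : 0 < ν)
    (hSodd : ∀ x, S (-x) = -S x) (hSmono : StrictMono S)
    (hPcont : Continuous P) (hWcont : Continuous W)
    (hEq : ∀ s t : ℝ, s ≤ t → P t - P s =
      (∫ u in s..t,
        (-μ * (1 - Real.exp ((if u < t₀ then Pm else Pp) - P u)) +
          ν * S (P u - P (u - 1)))) + (W t - W s))
    (hδm : 0 < δm) (hcm : 0 < cm)
    (hA1 : ∀ x, δm / 4 ≤ x → x ≤ δm →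
      -μ * (1 - Real.exp (-x)) + ν * S (x + δm) < -(cm * μ * δm))
    (hA2 : ∀ x, -δm ≤ x → x ≤ -(δm / 4) →
      cm * μ * δm < -μ * (1 - Real.exp (-x)) + ν * S (x - δm))
    (hab : δm < ab) (hεb : 0 < εb) (habroot : ν * S ab = μ + ab + εb)
    (hinit : ∀ t ∈ Set.Icc (t₀ - 1) t₀, |P t - Pm| < δm)
    (hinit₀ : |P t₀ - Pm| < δm / 2)
    (hjump : (2 * ab + 3 * δm) / min μ 1 ≤ Pp - Pm)
    (hW : ∀ t₂ t₃ : ℝ, t₀ ≤ t₂ → t₂ < t₃ → t₃ ≤ t₀ + 1 →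
      -(min δm εb / 2) < W t₃ - W t₂) :
    ∀ t₂ t₃ : ℝ, t₀ ≤ t₂ → t₂ < t₃ → t₃ ≤ t₀ + 1 →
      (ab + min δm εb) * (t₃ - t₂) - min δm εb / 2 < P t₃ - P t₂ := by
  set m := min δm εb with hm
  have hm1 : m ≤ δm := min_le_left _ _
  have hm2 : m ≤ εb := min_le_right _ _
  have hm0 : 0 < m := lt_min hδm hεb
  have hk0 : 0 < min μ 1 := lt_min hμ one_pos
  have hkμ : min μ 1 ≤ μ := min_le_left _ _
  have hk1 : min μ 1 ≤ 1 := min_le_right _ _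
  have hjump' : 2 * ab + 3 * δm ≤ (Pp - Pm) * min μ 1 := (div_le_iff₀ hk0).1 hjump
  -- the drift bound
  have drift : ∀ u, t₀ ≤ u → u ≤ t₀ + 1 → Pm - δm ≤ P u →
      ab + m ≤ -μ * (1 - Real.exp (Pp - P u)) + ν * S (P u - P (u - 1)) := by
    intro u hu1 hu2 hx
    have h1 := abs_lt.1 (hinit (u - 1) ⟨by linarith, by linarith⟩)
    rcases le_total (ab + δm) (P u - Pm) with h | h
    · have hS : S ab ≤ S (P u - P (u - 1)) := hSmono.monotone (by linarith [h1.2])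
      have h2 := mul_le_mul_of_nonneg_left hS hν.le
      have h3 := mul_pos hμ (Real.exp_pos (Pp - P u))
      nlinarith
    · have hS : S (-(δm + δm)) ≤ S (P u - P (u - 1)) := hSmono.monotone (by linarith [h1.2])
      rw [hSodd] at hS
      have h2 := mul_le_mul_of_nonneg_left hS hν.le
      have h3 := hA1 δm (by linarith) le_rfl
      have h4 := Real.add_one_le_exp (-δm)
      have h5 := Real.add_one_le_exp (Pp - P u)
      have h6 : μ * (1 - Real.exp (-δm)) ≤ μ * δm :=
        mul_le_mul_of_nonneg_left (by linarith) hμ.le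
      have h7 : μ * (Pp - P u) ≤ μ * (Real.exp (Pp - P u) - 1) :=
        mul_le_mul_of_nonneg_left (by linarith) hμ.le
      have h8 : 0 < cm * μ * δm := by positivity
      have h9 : ab + δm ≤ μ * (Pp - P u - δm) := by
        have h10 : ab + δm ≤ min μ 1 * (Pp - P u - δm) := by nlinarith
        have h11 : 0 < Pp - P u - δm := by
          by_contra hc
          push Not at hc
          nlinarith
        nlinarith
      nlinarith
  have integ : ∀ a b : ℝ, IntervalIntegrable
      (fun u => -μ * (1 - Real.exp (Pp - P u)) + ν * S (P u - P (u - 1)))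
      MeasureTheory.volume a b := by
    intro a b
    refine IntervalIntegrable.add ?_ ?_
    · apply Continuous.intervalIntegrable
      fun_prop
    · refine IntervalIntegrable.const_mul ?_ ν
      have hq : Continuous (fun u => P u - P (u - 1)) := by fun_prop
      obtain ⟨C, hC⟩ := (isCompact_uIcc (a := a) (b := b)).exists_bound_of_continuousOn
        hq.continuousOn
      rw [intervalIntegrable_iff']
      refine MeasureTheory.Measure.integrableOn_of_bounded (M := S C)
        (by simp [Set.uIcc]) ?_ ?_
      · exact (hSmono.monotone.measurable.comp hq.measurable).aestronglyMeasurable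
      · refine (MeasureTheory.ae_restrict_iff' measurableSet_uIcc).2 (.of_forall ?_)
        intro u hu
        have h1 := abs_le.1 (hC u hu)
        rw [Real.norm_eq_abs, abs_le, ← hSodd]
        exact ⟨hSmono.monotone h1.1, hSmono.monotone h1.2⟩
  have key : ∀ t₂ t₃ : ℝ, t₀ ≤ t₂ → t₂ < t₃ → t₃ ≤ t₀ + 1 →
      (∀ u ∈ Set.Icc t₂ t₃, Pm - δm ≤ P u) →
      (ab + m) * (t₃ - t₂) - m / 2 < P t₃ - P t₂ := by
    intro t₂ t₃ h2 h23 h3 hlow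
    have e : (∫ u in t₂..t₃,
        (-μ * (1 - Real.exp ((if u < t₀ then Pm else Pp) - P u)) +
          ν * S (P u - P (u - 1)))) =
        ∫ u in t₂..t₃, (-μ * (1 - Real.exp (Pp - P u)) + ν * S (P u - P (u - 1))) := by
      apply intervalIntegral.integral_congr
      intro u hu
      rw [Set.uIcc_of_le h23.le] at hu
      have : ¬ u < t₀ := not_lt.2 (h2.trans hu.1)
      simp only [this, if_false]
    have hint : (∫ _u in t₂..t₃, (ab + m)) ≤
        ∫ u in t₂..t₃, (-μ * (1 - Real.exp (Pp - P u)) + ν * S (P u - P (u - 1))) := by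
      apply intervalIntegral.integral_mono_on h23.le (by simp) (integ _ _)
      intro u hu
      exact drift u (h2.trans hu.1) (hu.2.trans h3) (hlow u hu)
    rw [intervalIntegral.integral_const, smul_eq_mul] at hint
    have hE := hEq t₂ t₃ h23.le
    rw [e] at hE
    have hw := hW t₂ t₃ h2 h23 h3
    linarith
  have low : ∀ u, t₀ ≤ u → u ≤ t₀ + 1 → Pm - δm ≤ P u := by
    by_contra hc
    push Not at hc
    obtain ⟨v, hv1, hv2, hv3⟩ := hc
    have hcomp : IsCompact (Set.Icc t₀ (t₀ + 1) ∩ {u | P u ≤ Pm - δm}) :=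
      isCompact_Icc.inter_right (isClosed_le hPcont continuous_const)
    obtain ⟨τ, ⟨⟨hτ1, hτ2⟩, hτ3⟩, hτ4⟩ := hcomp.exists_isLeast ⟨v, ⟨hv1, hv2⟩, hv3.le⟩
    have hτ3' : P τ ≤ Pm - δm := hτ3
    have h0 := abs_lt.1 hinit₀
    have hlt : t₀ < τ := by
      rcases hτ1.lt_or_eq with h | h
      · exact h
      · rw [← h] at hτ3'
        linarith [h0.1]
    have hbefore : ∀ u ∈ Set.Ico t₀ τ, Pm - δm ≤ P u := by
      intro u hu
      by_contra hcu
      push Not at hcu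
      exact absurd (hτ4 ⟨⟨hu.1, hu.2.le.trans hτ2⟩, hcu.le⟩) (not_le.2 hu.2)
    have hcl : ∀ u ∈ Set.Icc t₀ τ, Pm - δm ≤ P u := by
      have hsub : closure (Set.Ico t₀ τ) ⊆ {u | Pm - δm ≤ P u} :=
        closure_minimal hbefore (isClosed_le continuous_const hPcont)
      rw [closure_Ico hlt.ne] at hsub
      exact hsub
    have hk := key t₀ τ le_rfl hlt hτ2 hcl
    have hp : 0 < (ab + m) * (τ - t₀) := mul_pos (by linarith) (by linarith)
    linarith [h0.1]
  intro t₂ t₃ h2 h23 h3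
  exact key t₂ t₃ h2 h23 h3 fun u hu => low u (h2.trans hu.1) (hu.2.trans h3)
end
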